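/- arXiv:1706.00565 — 4 statements merged into one kernel-verified Lean document; each statement's English description precedes it below -/
import Mathlib

section
/- For each positive integer n and each e⃗ ∈ Ω_0, the matrix algebra (M_n(𝔽), 𝔽, ×_𝔽, ×, |·|) is an e⃗-Ramsey algebra. -/
universe u v

/-- A (heterogeneous) operation: a list of input sorts, an output sort, and an
underlying function on lists of elements (only its values on lists of the right
length and sorts matter). -/
structure HetOp (I : Type u) (U : Type v) where
  inSorts : List I
  outSort : I
  fn : List U → U

namespace HetRamsey

variable {I : Type u} {U : Type v}

/-- `f` maps the phyla prescribed by its input sorts into the phylum of its output sort. -/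
def WellSorted (A : I → Set U) (f : HetOp I U) : Prop :=
  ∀ xs : List U, List.Forall₂ (fun x ξ => x ∈ A ξ) xs f.inSorts → f.fn xs ∈ A f.outSort

/-- Apply the operations in `hs` to consecutive chunks of the list `xs`. -/
def applyChunks : List (HetOp I U) → List U → List U
  | [], _ => []
  | h :: t, xs => h.fn (xs.take h.inSorts.length) :: applyChunks t (xs.drop h.inSorts.length)

/-- The orderly terms over a family `F` of operations: `F` itself, the identity
operations, closed under orderly composition. -/
inductive OT (F : Set (HetOp I U)) : HetOp I U → Prop
  | base {f : HetOp I U} : f ∈ F → OT F f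
  | id (ξ : I) (c : HetOp I U) :
      c.inSorts = [ξ] → c.outSort = ξ → (∀ x : U, c.fn [x] = x) → OT F c
  | comp (g : HetOp I U) (hs : List (HetOp I U)) :
      g ∈ F → (∀ h ∈ hs, OT F h) →
      List.Forall₂ (fun (h : HetOp I U) ξ => h.outSort = ξ) hs g.inSorts →
      OT F ⟨(hs.map HetOp.inSorts).flatten, g.outSort, fun xs => g.fn (applyChunks hs xs)⟩

/-- `b` is `e`-sorted: the `i`-th term lies in phylum `A (e i)`. -/
def Sorted (A : I → Set U) (e : ℕ → I) (b : ℕ → U) : Prop :=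
  ∀ i, b i ∈ A (e i)

/-- `a` is a reduction of `b` with respect to the family of operations `F`:
each term `a j` is obtained by applying an orderly term over `F` to a finite
subsequence of `b`, and these finite subsequences concatenate to a
subsequence of `b`. -/
def Reduction (A : I → Set U) (F : Set (HetOp I U)) (a b : ℕ → U) : Prop :=
  ∃ (φ : ℕ → List ℕ) (f : ℕ → HetOp I U),
    (∀ j, OT F (f j)) ∧
    (∀ j, (φ j).Chain' (· < ·)) ∧
    (∀ j k, j < k → ∀ x ∈ φ j, ∀ y ∈ φ k, x < y) ∧
    (∀ j, List.Forall₂ (fun i ξ => b i ∈ A ξ) (φ j) (f j).inSorts) ∧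
    (∀ j, a j = (f j).fn ((φ j).map b))

/-- `FR^e_F(b)`: the set of first terms of `e`-sorted reductions of `b`. -/
def FR (A : I → Set U) (F : Set (HetOp I U)) (e : ℕ → I) (b : ℕ → U) : Set U :=
  { x | ∃ a : ℕ → U, Reduction A F a b ∧ Sorted A e a ∧ a 0 = x }

/-- The algebra with phyla `A` and operations `F` is an `e`-Ramsey algebra. -/
def IsERamsey (A : I → Set U) (F : Set (HetOp I U)) (e : ℕ → I) : Prop :=
  ∀ b : ℕ → U, Sorted A e b → ∀ X : Set U, X ⊆ A (e 0) →
    ∃ a : ℕ → U, Reduction A F a b ∧ Sorted A e a ∧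
      (FR A F e a ⊆ X ∨ FR A F e a ∩ X = ∅)

/-- The homogeneous algebra `(A ξ, F)` is a Ramsey algebra: it is `e`-Ramsey for
the constant sort with value `ξ`. -/
def IsRamsey (A : I → Set U) (F : Set (HetOp I U)) (ξ : I) : Prop :=
  IsERamsey A F fun _ => ξ

/-- For a homogeneous algebra: `FR_G(α) = { f(τ) : f ∈ OT(G), τ a finite subsequence of α }`. -/
def FRfin (A : I → Set U) (G : Set (HetOp I U)) (α : ℕ → U) : Set U :=
  { x | ∃ (f : HetOp I U) (ns : List ℕ), OT G f ∧ ns.Chain' (· < ·) ∧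
      List.Forall₂ (fun i ξ => α i ∈ A ξ) ns f.inSorts ∧ x = f.fn (ns.map α) }

/-- `e ∈ Ω`: every value attained by the sort `e` is attained infinitely often. -/
def InOmega (e : ℕ → I) : Prop :=
  ∀ i, {j | e j = e i}.Infinite

end HetRamsey
namespace HetRamsey

/-- The underlying universe of a matrix algebra: scalars (left) and matrices (right). -/
abbrev MatU (𝔽 : Type) (n : ℕ) : Type := 𝔽 ⊕ Matrix (Fin n) (Fin n) 𝔽

/-- The two phyla: index `0` is the scalar phylum `𝔽`, index `1` the matrix phylum. -/
def matPhyla (𝔽 : Type) (n : ℕ) : Fin 2 → Set (MatU 𝔽 n) :=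
  fun i => if i = 0 then Set.range Sum.inl else Set.range Sum.inr

def toScal {𝔽 : Type} [Zero 𝔽] {n : ℕ} : MatU 𝔽 n → 𝔽
  | Sum.inl r => r
  | Sum.inr _ => 0

def toMat {𝔽 : Type} [Zero 𝔽] {n : ℕ} : MatU 𝔽 n → Matrix (Fin n) (Fin n) 𝔽
  | Sum.inl _ => 0
  | Sum.inr m => m

/-- Matrix addition as a heterogeneous operation. -/
def matAddOp (𝔽 : Type) [Field 𝔽] (n : ℕ) : HetOp (Fin 2) (MatU 𝔽 n) :=
  ⟨[1, 1], 1, fun xs => match xs with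
    | [x, y] => Sum.inr (toMat x + toMat y)
    | _ => Sum.inl 0⟩

/-- Matrix multiplication as a heterogeneous operation. -/
def matMulOp (𝔽 : Type) [Field 𝔽] (n : ℕ) : HetOp (Fin 2) (MatU 𝔽 n) :=
  ⟨[1, 1], 1, fun xs => match xs with
    | [x, y] => Sum.inr (toMat x * toMat y)
    | _ => Sum.inl 0⟩

/-- Field addition as a heterogeneous operation. -/
def scalAddOp (𝔽 : Type) [Field 𝔽] (n : ℕ) : HetOp (Fin 2) (MatU 𝔽 n) :=
  ⟨[0, 0], 0, fun xs => match xs with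
    | [x, y] => Sum.inl (toScal x + toScal y)
    | _ => Sum.inl 0⟩

/-- Field multiplication as a heterogeneous operation. -/
def scalMulOp (𝔽 : Type) [Field 𝔽] (n : ℕ) : HetOp (Fin 2) (MatU 𝔽 n) :=
  ⟨[0, 0], 0, fun xs => match xs with
    | [x, y] => Sum.inl (toScal x * toScal y)
    | _ => Sum.inl 0⟩

/-- The determinant as a heterogeneous operation from the matrix phylum to the scalar phylum. -/
def detOp (𝔽 : Type) [Field 𝔽] (n : ℕ) : HetOp (Fin 2) (MatU 𝔽 n) :=
  ⟨[1], 0, fun xs => match xs with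
    | [x] => Sum.inl (toMat x).det
    | _ => Sum.inl 0⟩

end HetRamsey

open HetRamsey

/-- Products of `b` over nonempty strictly increasing words of indices are finite products of `b`. -/
theorem prod_map_get_mem_FP {M : Type*} [Monoid M] (b : Stream' M) (l : List ℕ) (hne : l ≠ [])
    (hl : l.Pairwise (· < ·)) (k : ℕ) (hk : ∀ i ∈ l, k ≤ i) :
    (l.map b.get).prod ∈ Hindman.FP (b.drop k) := by
  induction l generalizing k with
  | nil => exact absurd rfl hne
  | cons i l ih =>
    obtain ⟨hil, hinc⟩ := List.pairwise_cons.1 hl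
    obtain ⟨d, rfl⟩ := Nat.exists_eq_add_of_le (hk i (by simp))
    refine Hindman.FP_drop_subset_FP _ d ?_
    have hhead : b.get (k + d) = ((b.drop k).drop d).head := by
      simp [Stream'.get_drop]
    rw [List.map_cons, List.prod_cons, hhead]
    rcases eq_or_ne l [] with rfl | hl'
    · rw [List.map_nil, List.prod_nil, mul_one]
      exact Hindman.FP.head _
    · apply Hindman.FP.cons
      rw [Stream'.tail_eq_drop, Stream'.drop_drop, Stream'.drop_drop]
      exact ih hl' hinc _ fun j hj => by have := hil j hj; omega

/-- The sequence of generators of the free monoid on `ℕ`. -/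
def letters : Stream' (FreeMonoid ℕ) := FreeMonoid.of

/-- A finite product of the letters `k, k + 1, …` of the free monoid is a nonempty strictly
increasing word. -/
theorem toList_of_mem_FP (m : FreeMonoid ℕ) (k : ℕ)
    (hm : m ∈ Hindman.FP (letters.drop k)) :
    m.toList ≠ [] ∧ m.toList.Pairwise (· < ·) ∧ ∀ i ∈ m.toList, k ≤ i := by
  generalize hs : (letters.drop k) = s at hm
  have hhead (k : ℕ) : (letters.drop k).head = FreeMonoid.of k := by
    rw [Stream'.head_drop]; rfl
  have htail (k : ℕ) : (letters.drop k).tail =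
      letters.drop (k + 1) := by
    rw [Stream'.tail_eq_drop, Stream'.drop_drop]
  induction hm generalizing k with
  | head' a => subst hs; simp [hhead]
  | tail' a m _ ih =>
    subst hs
    obtain ⟨h1, h2, h3⟩ := ih (k + 1) (htail k).symm
    exact ⟨h1, h2, fun i hi => Nat.le_of_succ_le (h3 i hi)⟩
  | cons' a m _ ih =>
    subst hs
    obtain ⟨h1, h2, h3⟩ := ih (k + 1) (htail k).symm
    rw [hhead, FreeMonoid.toList_of_mul]
    refine ⟨by simp, List.pairwise_cons.2 ⟨h3, h2⟩, ?_⟩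
    rintro i (_ | ⟨_, hi⟩)
    · exact le_rfl
    · exact Nat.le_of_succ_le (h3 i hi)

/-- **Hindman's theorem** for blocks: for any two-colouring of the finite words there are
successive nonempty increasing blocks all of whose increasing concatenations get the same
colour. -/
theorem exists_homogeneous_blocks (C : List ℕ → Prop) :
    ∃ w : ℕ → List ℕ, (∀ j, w j ≠ []) ∧ (∀ j, (w j).Pairwise (· < ·)) ∧
      (∀ j k, j < k → ∀ x ∈ w j, ∀ y ∈ w k, x < y) ∧
      ((∀ l : List ℕ, l ≠ [] → l.Pairwise (· < ·) → C (l.flatMap w)) ∨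
        ∀ l : List ℕ, l ≠ [] → l.Pairwise (· < ·) → ¬ C (l.flatMap w)) := by
  let P : Set (FreeMonoid ℕ) := Hindman.FP letters
  obtain ⟨c, hc, b, hb⟩ := Hindman.FP_partition_regular letters
    {{m | m ∈ P ∧ C m.toList}, {m | m ∈ P ∧ ¬ C m.toList}} (by simp) fun m hm => by
      by_cases h : C m.toList
      · exact ⟨_, Or.inl rfl, hm, h⟩
      · exact ⟨_, Or.inr rfl, hm, h⟩
  have hcP : c ⊆ P := by
    rcases hc with rfl | rfl <;> exact fun m hm => hm.1
  have hword (m : FreeMonoid ℕ) (hm : m ∈ Hindman.FP b) :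
      m.toList ≠ [] ∧ m.toList.Pairwise (· < ·) :=
    have h := toList_of_mem_FP m 0 (hcP (hb hm))
    ⟨h.1, h.2.1⟩
  have hflat (l : List ℕ) (hne : l ≠ []) (hl : l.Pairwise (· < ·)) :
      FreeMonoid.ofList (l.flatMap fun j => (b.get j).toList) ∈ c := by
    have h := hb (prod_map_get_mem_FP b l hne hl 0 (by simp))
    convert h using 1
    apply FreeMonoid.toList.injective
    simp [FreeMonoid.toList_prod, List.flatMap, Function.comp_def]
  refine ⟨fun j => (b.get j).toList, fun j => (hword _ (Hindman.FP.singleton b j)).1,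
    fun j => (hword _ (Hindman.FP.singleton b j)).2, fun j k hjk => ?_, ?_⟩
  · have h := (hword _ (Hindman.FP.mul_two b j k hjk)).2
    rw [FreeMonoid.toList_mul] at h
    exact (List.pairwise_append.1 h).2.2
  · rcases hc with rfl | rfl
    · exact Or.inl fun l hne hl => (hflat l hne hl).2
    · exact Or.inr fun l hne hl => (hflat l hne hl).2

namespace HetRamsey

/-- Iterating a binary operation on the phylum `ξ` gives orderly terms of every positive arity. -/
theorem exists_OT_replicate {I : Type u} {U : Type v} [Nonempty U] {F : Set (HetOp I U)}
    {g : HetOp I U} (hg : g ∈ F) {ξ : I} (hin : g.inSorts = [ξ, ξ]) (hout : g.outSort = ξ)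
    (k : ℕ) :
    ∃ f, OT F f ∧ f.inSorts = List.replicate (k + 1) ξ ∧ f.outSort = ξ := by
  let c : HetOp I U := ⟨[ξ], ξ, fun xs => xs.headD (Classical.arbitrary U)⟩
  have hc : OT F c := OT.id ξ c rfl rfl fun _ => rfl
  induction k with
  | zero => exact ⟨c, hc, rfl, rfl⟩
  | succ k ih =>
    obtain ⟨f, hf, hfin, hfout⟩ := ih
    refine ⟨_, OT.comp g [c, f] hg (by simp [hc, hf]) (by simp [hin, hfout, c]), ?_, hout⟩
    simp [hfin, c, List.replicate_succ]

/-- The multiplicative weight of an element of a matrix algebra: a scalar is its own weight, the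
weight of a matrix is its determinant. -/
def weight {𝔽 : Type} [Field 𝔽] {n : ℕ} : MatU 𝔽 n → 𝔽
  | Sum.inl r => r
  | Sum.inr m => m.det

theorem mem_matPhyla_zero {𝔽 : Type} {n : ℕ} {x : MatU 𝔽 n} : x ∈ matPhyla 𝔽 n 0 ↔ ∃ r, x = Sum.inl r := by
  simp [matPhyla, eq_comm]

theorem mem_matPhyla_one {𝔽 : Type} {n : ℕ} {x : MatU 𝔽 n} : x ∈ matPhyla 𝔽 n 1 ↔ ∃ m, x = Sum.inr m := by
  simp [matPhyla, eq_comm]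

section

variable {𝔽 : Type} [Field 𝔽] {n : ℕ}

/-- An operation on a matrix algebra is multiplicative if it has positive arity, respects sorts,
and its values have the product of the weights of the arguments as weight. -/
def IsMultiplicative (f : HetOp (Fin 2) (MatU 𝔽 n)) : Prop :=
  f.inSorts ≠ [] ∧ ∀ xs, List.Forall₂ (fun x ξ => x ∈ matPhyla 𝔽 n ξ) xs f.inSorts →
    f.fn xs ∈ matPhyla 𝔽 n f.outSort ∧ weight (f.fn xs) = (xs.map weight).prod

theorem isMultiplicative_of_mem {f : HetOp (Fin 2) (MatU 𝔽 n)}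
    (hf : f ∈ ({scalMulOp 𝔽 n, matMulOp 𝔽 n, detOp 𝔽 n} : Set _)) : IsMultiplicative f := by
  rcases hf with rfl | rfl | rfl
  · refine ⟨by simp [scalMulOp], ?_⟩
    rintro _ (_ | ⟨hx, _ | ⟨hy, _ | _⟩⟩)
    obtain ⟨r, rfl⟩ := mem_matPhyla_zero.1 hx
    obtain ⟨s, rfl⟩ := mem_matPhyla_zero.1 hy
    exact ⟨mem_matPhyla_zero.2 ⟨_, rfl⟩, by simp [scalMulOp, weight, toScal]⟩
  · refine ⟨by simp [matMulOp], ?_⟩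
    rintro _ (_ | ⟨hx, _ | ⟨hy, _ | _⟩⟩)
    obtain ⟨r, rfl⟩ := mem_matPhyla_one.1 hx
    obtain ⟨s, rfl⟩ := mem_matPhyla_one.1 hy
    exact ⟨mem_matPhyla_one.2 ⟨_, rfl⟩, by simp [matMulOp, weight, toMat]⟩
  · refine ⟨by simp [detOp], ?_⟩
    rintro _ (_ | ⟨hx, _ | _⟩)
    obtain ⟨r, rfl⟩ := mem_matPhyla_one.1 hx
    exact ⟨mem_matPhyla_zero.2 ⟨_, rfl⟩, by simp [detOp, weight, toMat]⟩

theorem applyChunks_of_isMultiplicative (hs : List (HetOp (Fin 2) (MatU 𝔽 n)))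
    (hmul : ∀ h ∈ hs, IsMultiplicative h) (xs : List (MatU 𝔽 n))
    (hxs : List.Forall₂ (fun x ξ => x ∈ matPhyla 𝔽 n ξ) xs (hs.map HetOp.inSorts).flatten) :
    List.Forall₂ (fun x ξ => x ∈ matPhyla 𝔽 n ξ) (applyChunks hs xs) (hs.map HetOp.outSort) ∧
      ((applyChunks hs xs).map weight).prod = (xs.map weight).prod := by
  induction hs generalizing xs with
  | nil => simp_all [applyChunks]
  | cons h hs ih =>
    rw [List.map_cons, List.flatten_cons] at hxs
    have htake := List.forall₂_take_append _ _ _ hxs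
    have hdrop := List.forall₂_drop_append _ _ _ hxs
    obtain ⟨hsort, hweight⟩ := (hmul h (by simp)).2 _ htake
    obtain ⟨hsorts, hweights⟩ := ih (fun h' hh' => hmul h' (by simp [hh'])) _ hdrop
    refine ⟨List.Forall₂.cons hsort hsorts, ?_⟩
    rw [applyChunks, List.map_cons, List.prod_cons, hweight, hweights, ← List.prod_append,
      ← List.map_append, List.take_append_drop]

theorem OT.isMultiplicative {f : HetOp (Fin 2) (MatU 𝔽 n)}
    (hf : OT {scalMulOp 𝔽 n, matMulOp 𝔽 n, detOp 𝔽 n} f) : IsMultiplicative f := by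
  induction hf with
  | base hf => exact isMultiplicative_of_mem hf
  | id ξ c hin hout hc =>
    refine ⟨by simp [hin], ?_⟩
    rw [hin, hout]
    rintro _ (_ | ⟨hx, _ | _⟩)
    simpa [hc] using hx
  | comp g hs hg _ hsorts ih =>
    have hout : hs.map HetOp.outSort = g.inSorts := by
      rw [← List.forall₂_eq_eq_eq, List.forall₂_map_left_iff]
      exact hsorts
    obtain ⟨hne, hmul⟩ := isMultiplicative_of_mem hg
    refine ⟨?_, fun xs hxs => ?_⟩
    · intro h
      rw [← hout] at hne
      obtain ⟨h', hh'⟩ := List.exists_mem_of_ne_nil hs (by simpa using hne)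
      exact (ih h' hh').1 (List.flatten_eq_nil_iff.1 h _ (List.mem_map_of_mem hh'))
    · obtain ⟨hsort, hweight⟩ := applyChunks_of_isMultiplicative hs ih xs hxs
      rw [hout] at hsort
      obtain ⟨hg1, hg2⟩ := hmul _ hsort
      exact ⟨hg1, hg2.trans hweight⟩

/-- Matrix products and their determinants, respectively products of scalars, are orderly terms. -/
theorem exists_OT_matrix {ξ ζ : Fin 2} (h : ζ = ξ ∨ ξ = 1) (k : ℕ) :
    ∃ f, OT {scalMulOp 𝔽 n, matMulOp 𝔽 n, detOp 𝔽 n} f ∧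
      f.inSorts = List.replicate (k + 1) ξ ∧ f.outSort = ζ := by
  have hpow (ξ : Fin 2) : ∃ f, OT {scalMulOp 𝔽 n, matMulOp 𝔽 n, detOp 𝔽 n} f ∧
      f.inSorts = List.replicate (k + 1) ξ ∧ f.outSort = ξ := by
    fin_cases ξ
    · exact exists_OT_replicate (g := scalMulOp 𝔽 n) (by simp) rfl rfl k
    · exact exists_OT_replicate (g := matMulOp 𝔽 n) (by simp) rfl rfl k
  by_cases hζ : ζ = ξ
  · exact hζ ▸ hpow ξ
  · obtain rfl := h.resolve_left hζ
    obtain ⟨f, hf, hin, hout⟩ := hpow 1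
    refine ⟨_, OT.comp (detOp 𝔽 n) [f] (by simp) (by simp [hf]) (by simp [detOp, hout]),
      by simp [hin], ?_⟩
    simp only [detOp]
    omega

end

end HetRamsey

/-- for `e ∈ Ω₀`, the matrix algebra `(Mₙ(𝔽), 𝔽, ×_𝔽, ×, |·|)` is
an `e`-Ramsey algebra. -/
theorem scalMul_matMul_det_eRamsey
    (𝔽 : Type) [Field 𝔽] [CharZero 𝔽] (n : ℕ) (hn : 0 < n)
    (e : ℕ → Fin 2) (he : InOmega e) (he0 : e 0 = 0) :
    IsERamsey (matPhyla 𝔽 n) {scalMulOp 𝔽 n, matMulOp 𝔽 n, detOp 𝔽 n} e := by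
  obtain ⟨ξ, ν, hν, hνξ, hξ⟩ : ∃ (ξ : Fin 2) (ν : ℕ → ℕ), StrictMono ν ∧ (∀ i, e (ν i) = ξ) ∧
      ∀ j, e j = ξ ∨ ξ = 1 := by
    by_cases h : ∃ i, e i = 1
    · obtain ⟨i, hi⟩ := h
      have hinf : (Set.ofPred fun j => e j = 1).Infinite := hi ▸ he i
      exact ⟨1, _, Nat.nth_strictMono hinf, fun j => Nat.nth_mem_of_infinite hinf j,
        fun _ => Or.inr rfl⟩
    · push Not at h
      have h0 (j : ℕ) : e j = 0 := by have := h j; omega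
      exact ⟨0, id, strictMono_id, h0, fun j => Or.inl (h0 j)⟩
  intro b hb X _
  obtain ⟨w, hne, hinc, hlt, hhom⟩ := exists_homogeneous_blocks fun l =>
    (Sum.inl (l.map fun i => weight (b (ν i))).prod : MatU 𝔽 n) ∈ X
  have hterm (j : ℕ) : ∃ f, OT {scalMulOp 𝔽 n, matMulOp 𝔽 n, detOp 𝔽 n} f ∧
      f.inSorts = List.replicate (w j).length ξ ∧ f.outSort = e j := by
    have h := exists_OT_matrix (𝔽 := 𝔽) (n := n) (hξ j) ((w j).length - 1)
    rwa [Nat.sub_add_cancel (List.length_pos_iff.2 (hne j))] at h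
  choose f hf hin hout using hterm
  have hsort (j : ℕ) : List.Forall₂ (fun i ζ => b i ∈ matPhyla 𝔽 n ζ) ((w j).map ν)
      (f j).inSorts := by
    rw [hin, List.forall₂_map_left_iff, ← List.map_const', List.forall₂_map_right_iff,
      List.forall₂_same]
    exact fun i _ => hνξ i ▸ hb (ν i)
  let a : ℕ → MatU 𝔽 n := fun j => (f j).fn (((w j).map ν).map b)
  have ha (j : ℕ) := (hf j).isMultiplicative.2 (((w j).map ν).map b)
    (List.forall₂_map_left_iff.2 (hsort j))
  have hFR : ∀ x ∈ FR (matPhyla 𝔽 n) {scalMulOp 𝔽 n, matMulOp 𝔽 n, detOp 𝔽 n} e a,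
      ∃ l : List ℕ, l ≠ [] ∧ l.Pairwise (· < ·) ∧
        x = Sum.inl ((l.flatMap w).map fun i => weight (b (ν i))).prod := by
    rintro _ ⟨a', ⟨φ, g, hg, hφ, -, hφsort, ha'⟩, ha'sort, rfl⟩
    refine ⟨φ 0, ?_, List.isChain_iff_pairwise.1 (hφ 0), ?_⟩
    · intro h
      have h0 := hφsort 0
      rw [h, List.forall₂_nil_left_iff] at h0
      exact (hg 0).isMultiplicative.1 h0
    · have hw := ((hg 0).isMultiplicative.2 _ (List.forall₂_map_left_iff.2 (hφsort 0))).2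
      obtain ⟨r, hr⟩ := mem_matPhyla_zero.1 (he0 ▸ ha'sort 0)
      rw [← ha' 0, hr] at hw
      rw [hr]
      congr 1
      refine hw.trans ?_
      rw [List.flatMap, List.map_flatten, List.prod_flatten, List.map_map, List.map_map,
        List.map_map]
      congr 1
      refine List.map_congr_left fun j _ => ?_
      simpa [a, Function.comp_def] using (ha j).2
  refine ⟨a, ⟨fun j => (w j).map ν, f, hf, fun j => ?_, fun j k hjk => ?_, hsort, fun _ => rfl⟩,
    fun j => hout j ▸ (ha j).1, ?_⟩
  · exact List.isChain_iff_pairwise.2 ((hinc j).map ν fun _ _ h => hν h)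
  · intro x hx y hy
    obtain ⟨i, hi, rfl⟩ := List.mem_map.1 hx
    obtain ⟨i', hi', rfl⟩ := List.mem_map.1 hy
    exact hν (hlt j k hjk i hi i' hi')
  · refine hhom.imp (fun h x hx => ?_) fun h => Set.eq_empty_iff_forall_notMem.2 ?_
    · obtain ⟨l, hl, hl', rfl⟩ := hFR x hx
      exact h l hl hl'
    · rintro x ⟨hx, hxX⟩
      obtain ⟨l, hl, hl', rfl⟩ := hFR x hx
      exact h l hl hl' hxX
end

section
/- Let 𝓐 = (A_0, A_1, 𝓕) be a two-phylum algebra with 𝓕 = 𝓖_0 ∪ 𝓖_1 ∪ {h}, where 𝓖_0 consists of operations on A_0 alone, 𝓖_1 consists of operations on A_1 alone, and h : A_1 → A_0. Suppose 𝓐_1 = (A_1, 𝓖_1) is not a Ramsey algebra, witnessed by β⃗ ∈ ^ωA_1 and X ⊆ A_1 (i.e. no reduction α⃗ ≤_{𝓖_1} β⃗ satisfies FR_{𝓖_1}(α⃗) ⊆ X or FR_{𝓖_1}(α⃗) ∩ X = ∅), and suppose h is one-to-one on FR_{𝓖_1}(β⃗). Then 𝓐 is not an e⃗-Ramsey algebra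 for any nonconstant e⃗ ∈ Ω_0. -/
universe u v

open HetRamsey

namespace HetRamsey

variable {I : Type u} {U : Type v}

theorem length_applyChunks (hs : List (HetOp I U)) (xs : List U) :
    (applyChunks hs xs).length = hs.length := by
  induction hs generalizing xs with
  | nil => rfl
  | cons h t ih => simp [applyChunks, ih]

theorem applyChunks_append (hs₁ hs₂ : List (HetOp I U)) (xs : List U) :
    applyChunks (hs₁ ++ hs₂) xs =
      applyChunks hs₁ (xs.take (hs₁.map HetOp.inSorts).flatten.length) ++
        applyChunks hs₂ (xs.drop (hs₁.map HetOp.inSorts).flatten.length) := by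
  induction hs₁ generalizing xs with
  | nil => simp [applyChunks]
  | cons h t ih =>
    simp only [List.cons_append, applyChunks, List.map_cons, List.flatten_cons,
      List.length_append, ih, List.take_take, List.drop_take, List.drop_drop]
    simp

theorem forall₂_applyChunks {A : I → Set U} {hs : List (HetOp I U)}
    (hws : ∀ h ∈ hs, WellSorted A h) {ss : List I}
    (hss : List.Forall₂ (fun (h : HetOp I U) ξ => h.outSort = ξ) hs ss) {xs : List U}
    (hxs : List.Forall₂ (fun x ξ => x ∈ A ξ) xs (hs.map HetOp.inSorts).flatten) :
    List.Forall₂ (fun x ξ => x ∈ A ξ) (applyChunks hs xs) ss := by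
  induction hss generalizing xs with
  | nil => exact List.Forall₂.nil
  | @cons h ξ t ts hξ _ ih =>
    rw [List.map_cons, List.flatten_cons] at hxs
    refine List.Forall₂.cons ?_ (ih (fun k hk => hws k (List.mem_cons_of_mem _ hk)) ?_)
    · exact hξ ▸ hws h List.mem_cons_self _ (List.forall₂_take_append _ _ _ hxs)
    · exact List.forall₂_drop_append _ _ _ hxs

theorem OT.wellSorted {A : I → Set U} {F : Set (HetOp I U)}
    (hF : ∀ f ∈ F, WellSorted A f) {f : HetOp I U} (hf : OT F f) : WellSorted A f := by
  induction hf with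
  | base h => exact hF _ h
  | id ξ c hin hout hc =>
    intro xs hxs
    rw [hin] at hxs
    rcases hxs with _ | ⟨hx, hnil⟩
    cases hnil
    rw [hc, hout]
    exact hx
  | comp g hs hg _ hss ih =>
    intro xs hxs
    exact hF g hg _ (forall₂_applyChunks ih hss hxs)

theorem OT.mono {F G : Set (HetOp I U)} (hFG : F ⊆ G) {f : HetOp I U} (hf : OT F f) :
    OT G f := by
  induction hf with
  | base h => exact OT.base (hFG h)
  | id ξ c hin hout hc => exact OT.id ξ c hin hout hc
  | comp g hs hg _ hss ih => exact OT.comp g hs (hFG hg) ih hss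

/-- Orderly terms are closed under substitution of orderly terms. -/
theorem OT.exists_subst {F : Set (HetOp I U)} {f : HetOp I U} (hf : OT F f) :
    ∀ hs : List (HetOp I U), (∀ h ∈ hs, OT F h) →
      List.Forall₂ (fun (h : HetOp I U) ξ => h.outSort = ξ) hs f.inSorts →
      ∃ k : HetOp I U, OT F k ∧ k.inSorts = (hs.map HetOp.inSorts).flatten ∧
        k.outSort = f.outSort ∧
        ∀ xs : List U, xs.length = k.inSorts.length → k.fn xs = f.fn (applyChunks hs xs) := by
  induction hf with
  | @base f h =>
    intro hs hOT hss
    exact ⟨_, OT.comp f hs h hOT hss, rfl, rfl, fun _ _ => rfl⟩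
  | id ξ c hin hout hc =>
    intro hs hOT hss
    rw [hin] at hss
    rcases hss with _ | ⟨hξ, hnil⟩
    cases hnil
    rename_i h
    refine ⟨h, hOT h (by simp), by simp, by rw [hξ, hout], fun xs hxs => ?_⟩
    simp [applyChunks, hc, ← hxs]
  | comp g hs' hg hs'OT hss' ih =>
    intro hs hOT hss
    have key : ∀ l : List (HetOp I U), (∀ h ∈ l, h ∈ hs') → ∀ hs : List (HetOp I U),
        (∀ h ∈ hs, OT F h) →
        List.Forall₂ (fun (h : HetOp I U) ξ => h.outSort = ξ) hs
          (l.map HetOp.inSorts).flatten →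
        ∃ ks : List (HetOp I U), (∀ k ∈ ks, OT F k) ∧
          (ks.map HetOp.inSorts).flatten = (hs.map HetOp.inSorts).flatten ∧
          List.Forall₂ (fun k h : HetOp I U => k.outSort = h.outSort) ks l ∧
          ∀ xs : List U, xs.length = (ks.map HetOp.inSorts).flatten.length →
            applyChunks ks xs = applyChunks l (applyChunks hs xs) := by
      intro l
      induction l with
      | nil =>
        intro _ hs _ hss
        cases hss
        exact ⟨[], by simp, by simp, by simp, fun _ _ => rfl⟩
      | cons h t iht =>
        intro hl hs hOT hss
        rw [List.map_cons, List.flatten_cons] at hss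
        have h₁ := List.forall₂_take_append _ _ _ hss
        have h₂ := List.forall₂_drop_append _ _ _ hss
        have hlen := h₁.length_eq
        obtain ⟨hs₁, hs₂, hs_eq, e₁, e₂⟩ : ∃ hs₁ hs₂, hs = hs₁ ++ hs₂ ∧
            hs.take h.inSorts.length = hs₁ ∧ hs.drop h.inSorts.length = hs₂ :=
          ⟨_, _, (List.take_append_drop _ _).symm, rfl, rfl⟩
        rw [e₁] at h₁ hlen
        rw [e₂] at h₂
        subst hs_eq
        obtain ⟨k, hk, hkin, hkout, hkfn⟩ := ih h (hl h List.mem_cons_self) hs₁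
          (fun x hx => hOT x (List.mem_append_left _ hx)) h₁
        obtain ⟨ks, hks, hksin, hksout, hksfn⟩ :=
          iht (fun x hx => hl x (List.mem_cons_of_mem _ hx)) hs₂
            (fun x hx => hOT x (List.mem_append_right _ hx)) h₂
        refine ⟨k :: ks, ?_, ?_, List.Forall₂.cons hkout hksout, fun xs hxs => ?_⟩
        · simpa using ⟨hk, hks⟩
        · simp [hkin, hksin]
        · simp only [List.map_cons, List.flatten_cons, List.length_append] at hxs
          have hl₁ : (applyChunks hs₁ (xs.take k.inSorts.length)).length
              = h.inSorts.length := by rw [length_applyChunks, hlen]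
          rw [applyChunks_append, ← hkin, applyChunks, applyChunks, List.take_left' hl₁,
            List.drop_left' hl₁, hkfn _ (by rw [List.length_take]; omega),
            hksfn _ (by rw [List.length_drop]; omega)]
    obtain ⟨ks, hks, hksin, hksout, hksfn⟩ := key hs' (fun _ h => h) hs hOT hss
    refine ⟨_, OT.comp g ks hg hks ?_, hksin, rfl, fun xs hxs => ?_⟩
    · clear hksfn hksin hks hss ih hOT key hs'OT
      generalize g.inSorts = ss at hss'
      induction hksout generalizing ss with
      | nil => exact hss'
      | cons hkh _ ih =>
        cases hss' with
        | cons hξ htl => exact List.Forall₂.cons (hkh.trans hξ) (ih _ htl)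
    · exact congrArg g.fn (hksfn xs hxs)

theorem FRfin_subset_of_reduction {A : I → Set U} {G : Set (HetOp I U)}
    (hdisj : Pairwise fun ξ η => Disjoint (A ξ) (A η)) (hG : ∀ f ∈ G, WellSorted A f)
    {α β : ℕ → U} (hr : Reduction A G α β) : FRfin A G α ⊆ FRfin A G β := by
  rintro x ⟨f, ns, hf, hns, hsort, rfl⟩
  obtain ⟨φ, t, ht, hchain, hlt, hφ, hα⟩ := hr
  have hmem (i : ℕ) : α i ∈ A (t i).outSort := by
    rw [hα]
    exact (ht i).wellSorted hG _ (List.forall₂_map_left_iff.2 (hφ i))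
  obtain ⟨k, hk, hkin, -, hkfn⟩ := hf.exists_subst (ns.map t) (by simp [ht]) <| by
    rw [List.forall₂_map_left_iff]
    refine hsort.imp fun i ξ hi => ?_
    by_contra hne
    exact Set.disjoint_left.1 (hdisj hne) (hmem i) hi
  have hfor : List.Forall₂ (fun i ξ => β i ∈ A ξ) (ns.flatMap φ)
      ((ns.map t).map HetOp.inSorts).flatten := by
    clear hkfn hkin hsort hns
    induction ns with
    | nil => simp
    | cons n ns ih =>
      simp only [List.flatMap_cons, List.map_cons, List.flatten_cons]
      exact List.rel_append (hφ n) ih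
  have happ : applyChunks (ns.map t) ((ns.flatMap φ).map β) = ns.map α := by
    clear hkfn hkin hsort hns hfor
    induction ns with
    | nil => rfl
    | cons n ns ih =>
      have hl : ((φ n).map β).length = (t n).inSorts.length := by
        rw [List.length_map, (hφ n).length_eq]
      simp only [List.flatMap_cons, List.map_cons, List.map_append, applyChunks]
      rw [List.take_left' hl, List.drop_left' hl, ih, ← hα]
  refine ⟨k, ns.flatMap φ, hk, ?_, hkin ▸ hfor, ?_⟩
  · refine List.isChain_iff_pairwise.2 (List.pairwise_flatMap.2 ⟨fun n _ => ?_, ?_⟩)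
    · exact List.isChain_iff_pairwise.1 (hchain n)
    · exact (List.isChain_iff_pairwise.1 hns).imp fun h => hlt _ _ h
  · rw [hkfn _ (by rw [List.length_map, hkin, hfor.length_eq]), happ]

/-- For a sort in `Ω`, beyond any bound there is a subsequence of indices with the same sorts. -/
theorem exists_strictMono_sort_eq {e : ℕ → I} (he : InOmega e) (B : ℕ) :
    ∃ m : ℕ → ℕ, StrictMono m ∧ (∀ j, B < m j) ∧ ∀ j, e (m j) = e j := by
  have hex (j N : ℕ) : ∃ n, e n = e j ∧ N < n := (he j).exists_gt N
  choose g hg hgt using hex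
  let m : ℕ → ℕ := fun j => Nat.rec (g 0 B) (fun i r => g (i + 1) r) j
  have hm : StrictMono m := strictMono_nat_of_lt_succ fun j => hgt (j + 1) (m j)
  refine ⟨m, hm, fun j => (hgt 0 B).trans_le (hm.monotone j.zero_le), fun j => ?_⟩
  cases j with
  | zero => exact hg 0 B
  | succ j => exact hg (j + 1) (m j)

/-- For a sort in `Ω`, a finite subsequence of `a` can be continued to an `e`-sorted reduction,
so orderly terms of output sort `e 0` applied to finite subsequences of `a` lie in `FR`. -/
theorem mem_FR_of_OT {A : I → Set U} {F : Set (HetOp I U)} {e : ℕ → I} (he : InOmega e)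
    (hF : ∀ f ∈ F, WellSorted A f) {a : ℕ → U} (ha : Sorted A e a) {f : HetOp I U}
    (hf : OT F f) (hout : f.outSort = e 0) {ns : List ℕ} (hns : ns.Pairwise (· < ·))
    (hsort : List.Forall₂ (fun i ξ => a i ∈ A ξ) ns f.inSorts) :
    f.fn (ns.map a) ∈ FR A F e a := by
  obtain ⟨m, hm, hB, hme⟩ := exists_strictMono_sort_eq he ns.sum
  let φ : ℕ → List ℕ := fun j => if j = 0 then ns else [m j]
  let t : ℕ → HetOp I U := fun j =>
    if j = 0 then f else ⟨[e j], e j, fun xs => xs.headD (a 0)⟩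
  have hφ (j : ℕ) : List.Forall₂ (fun i ξ => a i ∈ A ξ) (φ j) (t j).inSorts := by
    by_cases hj : j = 0
    · simpa [φ, t, hj] using hsort
    · simpa [φ, t, hj] using hme j ▸ ha (m j)
  have ht (j : ℕ) : OT F (t j) := by
    by_cases hj : j = 0
    · simpa [t, hj] using hf
    · simpa [t, hj] using OT.id (e j) ⟨[e j], e j, fun xs => xs.headD (a 0)⟩ rfl rfl (by simp)
  have hto (j : ℕ) : (t j).outSort = e j := by
    by_cases hj : j = 0
    · simp [t, hj, hout]
    · simp [t, hj]
  refine ⟨fun j => (t j).fn ((φ j).map a), ⟨φ, t, ht, fun j => ?_, fun j k hjk x hx y hy => ?_,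
    hφ, fun _ => rfl⟩, fun j => ?_, by simp [t, φ]⟩
  · refine List.isChain_iff_pairwise.2 ?_
    by_cases hj : j = 0
    · simpa [φ, hj] using hns
    · simp [φ, hj]
  · have hk : k ≠ 0 := by omega
    simp only [φ, hk, if_false, List.mem_singleton] at hy
    subst hy
    by_cases hj : j = 0
    · simp only [φ, hj, if_true] at hx
      exact (List.le_sum_of_mem hx).trans_lt (hB k)
    · simp only [φ, hj, if_false, List.mem_singleton] at hx
      exact hx ▸ hm hjk
  · exact hto j ▸ (ht j).wellSorted hF _ (List.forall₂_map_left_iff.2 (hφ j))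

theorem OT.outSort_eq {F : Set (HetOp I U)} {ξ : I} (hF : ∀ f ∈ F, f.outSort = ξ)
    {f : HetOp I U} (hf : OT F f) (hin : ∀ η ∈ f.inSorts, η = ξ) : f.outSort = ξ := by
  cases hf with
  | base h => exact hF _ h
  | id η _ hc hout _ => exact hout.trans (hin η (by simp [hc]))
  | comp g _ hg => exact hF g hg

/-- If every operation of `F` with output sort `ξ` belongs to `G` and has all inputs of sort `ξ`,
then every orderly term over `F` with output sort `ξ` is one over `G`, with all inputs of
sort `ξ`. -/
theorem OT.restrict {F G : Set (HetOp I U)} {ξ : I}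
    (hF : ∀ f ∈ F, f.outSort = ξ → f ∈ G ∧ ∀ η ∈ f.inSorts, η = ξ)
    {f : HetOp I U} (hf : OT F f) (hout : f.outSort = ξ) :
    OT G f ∧ ∀ η ∈ f.inSorts, η = ξ := by
  induction hf with
  | base h => exact ⟨OT.base (hF _ h hout).1, (hF _ h hout).2⟩
  | id η c hin hc hid =>
    exact ⟨OT.id η c hin hc hid, by simp [hin, ← hc, hout]⟩
  | comp g hs hg _ hss ih =>
    obtain ⟨hgG, hgin⟩ := hF g hg hout
    have hhs : ∀ h ∈ hs, h.outSort = ξ := by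
      clear ih hg
      generalize g.inSorts = ss at hss hgin
      induction hss with
      | nil => simp
      | cons h _ ih' => simp_all
    refine ⟨OT.comp g hs hgG (fun h hh => (ih h hh (hhs h hh)).1) hss, fun η hη => ?_⟩
    simp only [List.mem_flatten, List.mem_map] at hη
    obtain ⟨_, ⟨h, hh, rfl⟩, hη⟩ := hη
    exact (ih h hh (hhs h hh)).2 η hη

end HetRamsey

/-- let `(A 0, A 1, 𝓖₀ ∪ 𝓖₁ ∪ {h})` be a two-phylum algebra with
`h : A 1 → A 0`. If `(A 1, 𝓖₁)` fails to be a Ramsey algebra, witnessed by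
`β⃗ ∈ ^ω(A 1)` and `X ⊆ A 1`, and `h` is one-to-one on `FR_{𝓖₁}(β⃗)`, then the
algebra is not `e`-Ramsey for any nonconstant `e ∈ Ω₀`. -/
theorem not_eRamsey_of_matrixPart_not_ramsey_of_injOn
    {U : Type v}
    (A : Fin 2 → Set U) (G0 G1 : Set (HetOp (Fin 2) U)) (hOp : HetOp (Fin 2) U)
    (hne : ∀ ξ, (A ξ).Nonempty)
    (hdisj : Pairwise fun ξ η => Disjoint (A ξ) (A η))
    (hG0 : ∀ f ∈ G0, f.outSort = 0 ∧ (∀ ξ ∈ f.inSorts, ξ = 0) ∧ WellSorted A f)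
    (hG1 : ∀ f ∈ G1, f.outSort = 1 ∧ (∀ ξ ∈ f.inSorts, ξ = 1) ∧ WellSorted A f)
    (hin : hOp.inSorts = [1]) (hout : hOp.outSort = 0) (hws : WellSorted A hOp)
    -- `β⃗` and `X` witness that `(A 1, 𝓖₁)` is not a Ramsey algebra
    (β : ℕ → U) (hβ : ∀ i, β i ∈ A 1) (X : Set U) (hX : X ⊆ A 1)
    (hwit : ∀ α : ℕ → U, Reduction A G1 α β → (∀ i, α i ∈ A 1) →
        ¬(FRfin A G1 α ⊆ X ∨ FRfin A G1 α ∩ X = ∅))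
    -- `h` is one-to-one on `FR_{𝓖₁}(β⃗)`
    (hinj : Set.InjOn (fun x => hOp.fn [x]) (FRfin A G1 β))
    (e : ℕ → Fin 2) (he : InOmega e) (he0 : e 0 = 0)
    (hnc : ∃ i j, e i ≠ e j) :
    ¬ IsERamsey A (G0 ∪ G1 ∪ {hOp}) e := by
  have hG1' : ∀ f ∈ G1, WellSorted A f := fun f hf => (hG1 f hf).2.2
  have hFws : ∀ f ∈ G0 ∪ G1 ∪ {hOp}, WellSorted A f := by
    rintro f ((hf | hf) | rfl)
    exacts [(hG0 f hf).2.2, hG1' f hf, hws]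
  have hF1 : ∀ f ∈ G0 ∪ G1 ∪ {hOp}, f.outSort = 1 → f ∈ G1 ∧ ∀ η ∈ f.inSorts, η = 1 := by
    rintro f ((hf | hf) | rfl) h1
    · exact absurd ((hG0 f hf).1.symm.trans h1) (by decide)
    · exact ⟨hf, (hG1 f hf).2.1⟩
    · exact absurd (hout.symm.trans h1) (by decide)
  have hsort_unique {x : U} {ξ η : Fin 2} (hξ : x ∈ A ξ) (hη : x ∈ A η) : ξ = η := by
    by_contra h
    exact Set.disjoint_left.1 (hdisj h) hξ hη
  have hmap {x : U} (hx : x ∈ A 1) : hOp.fn [x] ∈ A 0 := by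
    simpa [hout] using hws [x] (by simpa [hin] using hx)
  have hinf : {j | e j = 1}.Infinite := by
    obtain ⟨i, hi⟩ : ∃ i, e i = 1 := by
      by_contra! h
      obtain ⟨i, j, hij⟩ := hnc
      have := h i
      have := h j
      omega
    exact hi ▸ he i
  obtain ⟨c, hc⟩ := hne 0
  intro hR
  obtain ⟨a, hab, ha, hFR⟩ := hR (fun i => if e i = 1 then β i else c)
    (fun i => by
      by_cases h : e i = 1
      · simpa [h] using hβ i
      · have h0 : e i = 0 := by omega
        simpa [h0] using hc)
    ((fun x => hOp.fn [x]) '' (X ∩ FRfin A G1 β))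
    (by
      rintro _ ⟨x, ⟨hx, -⟩, rfl⟩
      exact he0 ▸ hmap (hX hx))
  obtain ⟨n, hn, hen⟩ : ∃ n : ℕ → ℕ, StrictMono n ∧ ∀ j, e (n j) = 1 :=
    ⟨Nat.nth (fun j => e j = 1), Nat.nth_strictMono hinf, Nat.nth_mem_of_infinite hinf⟩
  have hα (j : ℕ) : a (n j) ∈ A 1 := hen j ▸ ha (n j)
  have hred : Reduction A G1 (a ∘ n) β := by
    obtain ⟨φ, t, ht, hchain, hlt, hφ, hat⟩ := hab
    have htout (j : ℕ) : (t (n j)).outSort = 1 := by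
      refine hsort_unique ?_ (hα j)
      rw [hat]
      exact (ht _).wellSorted hFws _ (List.forall₂_map_left_iff.2 (hφ _))
    have hres (j : ℕ) := (ht (n j)).restrict hF1 (htout j)
    have hφe (j i : ℕ) (hi : i ∈ φ (n j)) : e i = 1 := by
      obtain ⟨ξ, hξ, hiξ⟩ : ∃ ξ ∈ (t (n j)).inSorts, (if e i = 1 then β i else c) ∈ A ξ := by
        have := hφ (n j)
        generalize (t (n j)).inSorts = ss, φ (n j) = is at this hi
        induction this with
        | nil => simp at hi
        | cons h _ ih => grind
      by_contra h
      rw [if_neg h, (hres j).2 ξ hξ] at hiξ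
      exact absurd (hsort_unique hc hiξ) (by decide)
    have hmapβ (j : ℕ) :
        (φ (n j)).map (fun i => if e i = 1 then β i else c) = (φ (n j)).map β :=
      List.map_congr_left fun i hi => if_pos (hφe j i hi)
    refine ⟨φ ∘ n, t ∘ n, fun j => (hres j).1, fun j => hchain _,
      fun j k hjk => hlt _ _ (hn hjk), fun j => ?_, fun j => ?_⟩
    · have h := List.forall₂_map_left_iff (R := fun x ξ => x ∈ A ξ)
        (f := fun i => if e i = 1 then β i else c) |>.2 (hφ (n j))
      rw [hmapβ] at h
      exact List.forall₂_map_left_iff.1 h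
    · rw [Function.comp_apply, hat, hmapβ]
      rfl
  have hsub := FRfin_subset_of_reduction hdisj hG1' hred
  have himage {x : U} (hx : x ∈ FRfin A G1 (a ∘ n)) :
      hOp.fn [x] ∈ FR A (G0 ∪ G1 ∪ {hOp}) e a := by
    obtain ⟨f, ns, hf, hns, hsort, rfl⟩ := hx
    have hfin : ∀ η ∈ f.inSorts, η = 1 := by
      clear hns
      generalize f.inSorts = ss at hsort
      induction hsort with
      | nil => simp
      | cons h _ ih => exact List.forall_mem_cons.2 ⟨hsort_unique h (hα _), ih⟩
    have hfout : f.outSort = 1 := hf.outSort_eq (fun g hg => (hG1 g hg).1) hfin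
    have hcomp : OT (G0 ∪ G1 ∪ {hOp}) _ := OT.comp hOp [f] (by simp)
      (List.forall_mem_singleton.2 (hf.mono fun g hg => Or.inl (Or.inr hg))) (by simpa [hin] using hfout)
    have hmem := mem_FR_of_OT he hFws ha hcomp (ns := ns.map n) (hout.trans he0.symm)
      (List.pairwise_map.2 ((List.isChain_iff_pairwise.1 hns).imp fun h => hn h))
      (by simpa using hsort)
    simpa [applyChunks, List.take_of_length_le, hsort.length_eq] using hmem
  refine hwit (a ∘ n) hred hα (hFR.imp (fun h x hx => ?_) fun h => ?_)
  · obtain ⟨y, ⟨hyX, hyβ⟩, hyx⟩ := h (himage hx)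
    exact hinj hyβ (hsub hx) hyx ▸ hyX
  · refine Set.eq_empty_iff_forall_notMem.2 fun x ⟨hx, hxX⟩ => ?_
    exact Set.eq_empty_iff_forall_notMem.1 h _ ⟨himage hx, x, ⟨hxX, hsub hx⟩, rfl⟩
end

section
/- For each positive integer n and each nonconstant e⃗ ∈ Ω_0, none of the matrix algebras (M_n(𝔽), 𝔽, +, ×, |·|), (M_n(𝔽), 𝔽, +, ×, +_𝔽, |·|), (M_n(𝔽), 𝔽, +, ×, ×_𝔽, |·|), and (M_n(𝔽), 𝔽, +, ×, +_𝔽, ×_𝔽, |·|) is an e⃗-Ramsey algebra. -/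
universe u v

open HetRamsey

namespace HetRamsey

/-- The number whose binary digits equal to one sit at the positions in `T`. -/
def ofBits (T : Finset ℕ) : ℕ := ∑ s ∈ T, 2 ^ s

/-- `T` is a nonempty set of positive multiples of `2 ^ lo` below `2 ^ hi`. -/
def BitBlock (lo hi : ℕ) (T : Finset ℕ) : Prop :=
  T.Nonempty ∧ ∀ s ∈ T, 0 < s ∧ 2 ^ lo ∣ s ∧ s < 2 ^ hi

/-- A power of two dividing the largest element of `T` exceeds some element of `T`. -/
def SumLike (T : Finset ℕ) : Prop :=
  ∃ m, (∃ s ∈ T, s < 2 ^ m) ∧ ∃ t ∈ T, (∀ u ∈ T, u ≤ t) ∧ 2 ^ m ∣ t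

theorem ofBits_injective : Function.Injective ofBits :=
  Finset.geomSum_injective (le_refl 2)

theorem BitBlock.mono {lo hi lo' hi' : ℕ} {T : Finset ℕ} (h : BitBlock lo' hi' T)
    (hlo : lo ≤ lo') (hhi : hi' ≤ hi) : BitBlock lo hi T :=
  ⟨h.1, fun s hs => ⟨(h.2 s hs).1, (pow_dvd_pow 2 hlo).trans (h.2 s hs).2.1,
    (h.2 s hs).2.2.trans_le (Nat.pow_le_pow_right (by norm_num) hhi)⟩⟩

theorem BitBlock.lt {lo mid hi : ℕ} {S T : Finset ℕ} (hS : BitBlock lo mid S)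
    (hT : BitBlock mid hi T) {s t : ℕ} (hs : s ∈ S) (ht : t ∈ T) : s < t :=
  (hS.2 s hs).2.2.trans_le (Nat.le_of_dvd (hT.2 t ht).1 (hT.2 t ht).2.1)

theorem BitBlock.add {lo mid hi : ℕ} {S T : Finset ℕ} (hS : BitBlock lo mid S)
    (hT : BitBlock mid hi T) (h₁ : lo ≤ mid) (h₂ : mid ≤ hi) :
    BitBlock lo hi (S ∪ T) ∧ ofBits (S ∪ T) = ofBits S + ofBits T ∧ SumLike (S ∪ T) := by
  refine ⟨⟨hS.1.mono Finset.subset_union_left, fun s hs => ?_⟩, ?_, mid, ?_, ?_⟩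
  · rcases Finset.mem_union.1 hs with hs | hs
    · exact (hS.mono le_rfl h₂).2 s hs
    · exact (hT.mono h₁ le_rfl).2 s hs
  · refine Finset.sum_union (Finset.disjoint_left.2 fun s hs ht => ?_)
    exact (hS.lt hT hs ht).false
  · obtain ⟨s, hs⟩ := hS.1
    exact ⟨s, Finset.mem_union_left _ hs, (hS.2 s hs).2.2⟩
  · obtain ⟨t, ht, hmax⟩ := T.exists_max_image id hT.1
    refine ⟨t, Finset.mem_union_right _ ht, fun u hu => ?_, (hT.2 t ht).2.1⟩
    rcases Finset.mem_union.1 hu with hu | hu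
    · exact (hS.lt hT hu ht).le
    · exact hmax u hu

theorem BitBlock.mul {lo mid hi : ℕ} {S T : Finset ℕ} (hS : BitBlock lo mid S)
    (hT : BitBlock mid hi T) (h₁ : lo ≤ mid) :
    ∃ R, BitBlock lo hi R ∧ ofBits R = ofBits S * ofBits T ∧ ¬ SumLike R := by
  refine ⟨(S ×ˢ T).image fun p => p.1 + p.2,
    ⟨(hS.1.product hT.1).image _, fun r hr => ?_⟩, ?_, ?_⟩
  · obtain ⟨⟨s, t⟩, hst, rfl⟩ := Finset.mem_image.1 hr
    obtain ⟨hs, ht⟩ := Finset.mem_product.1 hst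
    obtain ⟨s0, sd, sl⟩ := hS.2 s hs
    obtain ⟨t0, td, tl⟩ := hT.2 t ht
    refine ⟨by simp only; omega, dvd_add sd ((pow_dvd_pow 2 h₁).trans td), ?_⟩
    have hle : mid ≤ hi := by
      by_contra hlt
      have := Nat.le_of_dvd t0 td
      have := Nat.pow_le_pow_right (n := 2) (by norm_num) (not_le.1 hlt).le
      omega
    obtain ⟨k, rfl⟩ := td
    obtain ⟨d, rfl⟩ := Nat.exists_eq_add_of_le hle
    rw [pow_add] at tl ⊢
    have hk : k < 2 ^ d := Nat.lt_of_mul_lt_mul_left tl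
    have : 2 ^ mid * (k + 1) ≤ 2 ^ mid * 2 ^ d := Nat.mul_le_mul_left _ hk
    simp only
    rw [mul_add] at this
    omega
  · unfold ofBits
    rw [Finset.sum_image, Finset.sum_mul_sum, Finset.sum_product]
    · simp only [pow_add]
    · rintro ⟨s, t⟩ hst ⟨s', t'⟩ hst' heq
      simp only [Finset.coe_product, Set.mem_prod, Finset.mem_coe] at hst hst' heq
      have hmod : ∀ x ∈ S, ∀ y ∈ T, (x + y) % 2 ^ mid = x := fun x hx y hy => by
        rw [Nat.add_mod, Nat.mod_eq_zero_of_dvd (hT.2 y hy).2.1, add_zero, Nat.mod_mod,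
          Nat.mod_eq_of_lt (hS.2 x hx).2.2]
      have hs : s = s' := by
        rw [← hmod s hst.1 t hst.2, heq, hmod s' hst'.1 t' hst'.2]
      subst hs
      simpa using heq
  · rintro ⟨m, ⟨r, hr, hrm⟩, u, hu, -, hmu⟩
    obtain ⟨⟨s, t⟩, hst, rfl⟩ := Finset.mem_image.1 hr
    obtain ⟨⟨s', t'⟩, hst', rfl⟩ := Finset.mem_image.1 hu
    have ht := hT.2 t (Finset.mem_product.1 hst).2
    have hs' := hS.2 s' (Finset.mem_product.1 hst').1
    have ht' := hT.2 t' (Finset.mem_product.1 hst').2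
    have hm : mid ≤ m := by
      by_contra hlt
      have := Nat.le_of_dvd ht.1 ht.2.1
      have := Nat.pow_le_pow_right (n := 2) (by norm_num) (not_le.1 hlt).le
      simp only at hrm
      omega
    have := Nat.le_of_dvd hs'.1
      ((Nat.dvd_add_left ht'.2.1).1 ((pow_dvd_pow 2 hm).trans hmu))
    omega

theorem exists_separator {l₁ l₂ : List ℕ} {lo hi : ℕ} (hle : lo ≤ hi)
    (h : ∀ x ∈ l₁, ∀ y ∈ l₂, x < y) (h₁ : ∀ x ∈ l₁, lo ≤ x ∧ x < hi)
    (h₂ : ∀ x ∈ l₂, lo ≤ x ∧ x < hi) :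
    ∃ mid, lo ≤ mid ∧ mid ≤ hi ∧ (∀ x ∈ l₁, lo ≤ x ∧ x < mid) ∧
      ∀ x ∈ l₂, mid ≤ x ∧ x < hi := by
  refine ⟨max lo (l₁.toFinset.sup (· + 1)), le_max_left _ _, max_le hle ?_, fun x hx => ?_,
    fun y hy => ⟨max_le (h₂ y hy).1 ?_, (h₂ y hy).2⟩⟩
  · exact Finset.sup_le fun x hx => (h₁ x (List.mem_toFinset.1 hx)).2
  · refine ⟨(h₁ x hx).1, lt_max_of_lt_right ?_⟩
    exact Nat.lt_of_succ_le (Finset.le_sup (f := (· + 1)) (List.mem_toFinset.2 hx))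
  · exact Finset.sup_le fun x hx => h x (List.mem_toFinset.1 hx) y hy

section Field

variable {𝔽 : Type} [Field 𝔽] {n : ℕ}

/-- `x` is the scalar matrix of a number whose bits form a block between `lo` and `hi`. -/
def IsBlockMat (lo hi : ℕ) (x : MatU 𝔽 n) : Prop :=
  ∃ T, BitBlock lo hi T ∧ x = Sum.inr ((ofBits T : ℕ) : Matrix (Fin n) (Fin n) 𝔽)

theorem IsBlockMat.add {lo mid hi : ℕ} {x y : MatU 𝔽 n} (hx : IsBlockMat lo mid x)
    (hy : IsBlockMat mid hi y) (h₁ : lo ≤ mid) (h₂ : mid ≤ hi) :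
    IsBlockMat lo hi ((matAddOp 𝔽 n).fn [x, y]) := by
  obtain ⟨S, hS, rfl⟩ := hx
  obtain ⟨T, hT, rfl⟩ := hy
  obtain ⟨hST, heq, -⟩ := hS.add hT h₁ h₂
  exact ⟨S ∪ T, hST, by simp [matAddOp, toMat, heq]⟩

theorem IsBlockMat.mul {lo mid hi : ℕ} {x y : MatU 𝔽 n} (hx : IsBlockMat lo mid x)
    (hy : IsBlockMat mid hi y) (h₁ : lo ≤ mid) :
    IsBlockMat lo hi ((matMulOp 𝔽 n).fn [x, y]) := by
  obtain ⟨S, hS, rfl⟩ := hx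
  obtain ⟨T, hT, rfl⟩ := hy
  obtain ⟨R, hR, heq, -⟩ := hS.mul hT h₁
  exact ⟨R, hR, by simp [matMulOp, toMat, heq]⟩

/-- The matrix-valued operations of `F` are among matrix addition and multiplication, and all
other operations are scalar-valued. -/
def MatrixOpsAddMul (F : Set (HetOp (Fin 2) (MatU 𝔽 n))) : Prop :=
  ∀ g ∈ F, g = matAddOp 𝔽 n ∨ g = matMulOp 𝔽 n ∨
    (g.outSort = 0 ∧ ∀ xs, g.fn xs ∈ Set.range Sum.inl)

/-- The sequence with the scalar matrix of `2 ^ 2 ^ i` at each matrix position `i` and the scalar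
`0` elsewhere. -/
def towerSeq (𝔽 : Type) [Field 𝔽] (n : ℕ) (e : ℕ → Fin 2) (i : ℕ) : MatU 𝔽 n :=
  if e i = 0 then Sum.inl 0 else Sum.inr ((ofBits {2 ^ i} : ℕ) : Matrix (Fin n) (Fin n) 𝔽)

theorem towerSeq_sorted (e : ℕ → Fin 2) : Sorted (matPhyla 𝔽 n) e (towerSeq 𝔽 n e) := by
  intro i
  unfold towerSeq matPhyla
  by_cases h : e i = 0 <;> simp [h]

theorem isBlockMat_towerSeq {e : ℕ → Fin 2} {i lo hi : ℕ}
    (h : towerSeq 𝔽 n e i ∈ matPhyla 𝔽 n 1) (hlo : lo ≤ i) (hhi : i < hi) :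
    IsBlockMat lo hi (towerSeq 𝔽 n e i) := by
  by_cases hi0 : e i = 0
  · simp [towerSeq, matPhyla, hi0] at h
  · refine ⟨{2 ^ i}, BitBlock.mono (lo' := i) (hi' := i + 1) ?_ hlo hhi, by simp [towerSeq, hi0]⟩
    simp [BitBlock, Nat.pow_lt_pow_right]

theorem exists_isBlockMat_pair {e : ℕ → Fin 2} {l : List ℕ} {lo hi : ℕ}
    (hl : l.Pairwise (· < ·)) (hb : ∀ x ∈ l, lo ≤ x ∧ x < hi)
    (hsort : List.Forall₂ (fun i ξ => towerSeq 𝔽 n e i ∈ matPhyla 𝔽 n ξ) l [1, 1]) :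
    ∃ x y mid, l.map (towerSeq 𝔽 n e) = [x, y] ∧ IsBlockMat lo mid x ∧
      IsBlockMat mid hi y ∧ lo ≤ mid ∧ mid ≤ hi := by
  obtain ⟨i, l', hi1, hl', rfl⟩ := List.forall₂_cons_right_iff.1 hsort
  obtain ⟨j, l'', hj1, hl'', rfl⟩ := List.forall₂_cons_right_iff.1 hl'
  obtain rfl := List.forall₂_nil_right_iff.1 hl''
  have hij : i < j := by simpa using hl
  have hi' := hb i (by simp)
  have hj' := hb j (by simp)
  exact ⟨_, _, j, rfl, isBlockMat_towerSeq hi1 hi'.1 hij,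
    isBlockMat_towerSeq hj1 le_rfl hj'.2, hj'.1, hj'.2.le⟩

theorem OT.outSort_eq_one {F : Set (HetOp (Fin 2) (MatU 𝔽 n))} (hF : MatrixOpsAddMul F)
    {f : HetOp (Fin 2) (MatU 𝔽 n)} (hf : OT F f) {xs : List (MatU 𝔽 n)}
    (hxs : List.Forall₂ (fun x ξ => x ∈ matPhyla 𝔽 n ξ) xs f.inSorts)
    (h : f.fn xs ∈ matPhyla 𝔽 n 1) : f.outSort = 1 := by
  have key : ∀ g ∈ F, ∀ ys, g.fn ys ∈ matPhyla 𝔽 n 1 → g.outSort = 1 := by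
    intro g hg ys hys
    rcases hF g hg with rfl | rfl | ⟨-, hr⟩
    · rfl
    · rfl
    · obtain ⟨r, hr⟩ := hr ys
      simp [matPhyla, ← hr] at hys
  cases hf with
  | base hg => exact key f hg _ h
  | id ξ c hin hout hid =>
    rw [hin] at hxs
    obtain ⟨x, l, hx, hl, rfl⟩ := List.forall₂_cons_right_iff.1 hxs
    obtain rfl := List.forall₂_nil_right_iff.1 hl
    rw [hid] at h
    rw [hout]
    by_contra hξ
    have hξ0 : ξ = 0 := by omega
    subst hξ0
    obtain ⟨r, rfl⟩ : x ∈ Set.range Sum.inl := by simpa [matPhyla] using hx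
    simp [matPhyla] at h
  | comp g hs hg => exact key g hg _ h

theorem OT.isBlockMat {F : Set (HetOp (Fin 2) (MatU 𝔽 n))} (hF : MatrixOpsAddMul F)
    {e : ℕ → Fin 2} {f : HetOp (Fin 2) (MatU 𝔽 n)} (hf : OT F f) (h1 : f.outSort = 1)
    (l : List ℕ) (lo hi : ℕ) (hle : lo ≤ hi) (hl : l.Pairwise (· < ·))
    (hb : ∀ x ∈ l, lo ≤ x ∧ x < hi)
    (hsort : List.Forall₂ (fun i ξ => towerSeq 𝔽 n e i ∈ matPhyla 𝔽 n ξ) l f.inSorts) :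
    IsBlockMat lo hi (f.fn (l.map (towerSeq 𝔽 n e))) := by
  induction hf generalizing l lo hi with
  | base hg =>
    rcases hF _ hg with rfl | rfl | ⟨h0, -⟩
    · obtain ⟨x, y, mid, hxy, hx, hy, h₁, h₂⟩ := exists_isBlockMat_pair hl hb hsort
      rw [hxy]
      exact hx.add hy h₁ h₂
    · obtain ⟨x, y, mid, hxy, hx, hy, h₁, h₂⟩ := exists_isBlockMat_pair hl hb hsort
      rw [hxy]
      exact hx.mul hy h₁
    · simp [h0] at h1
  | id ξ c hin hout hid =>
    obtain rfl : ξ = 1 := hout.symm.trans h1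
    rw [hin] at hsort
    obtain ⟨i, l', hi1, hl', rfl⟩ := List.forall₂_cons_right_iff.1 hsort
    obtain rfl := List.forall₂_nil_right_iff.1 hl'
    have hi' := hb i (by simp)
    simpa [hid] using isBlockMat_towerSeq hi1 hi'.1 hi'.2
  | comp g hs hg hOT hout ih =>
    have split : g.inSorts = [1, 1] → ∃ x y mid,
        applyChunks hs (l.map (towerSeq 𝔽 n e)) = [x, y] ∧ IsBlockMat lo mid x ∧
        IsBlockMat mid hi y ∧ lo ≤ mid ∧ mid ≤ hi := by
      intro hin
      rw [hin] at hout
      obtain ⟨k₁, t, hk₁, ht, rfl⟩ := List.forall₂_cons_right_iff.1 hout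
      obtain ⟨k₂, t', hk₂, ht', rfl⟩ := List.forall₂_cons_right_iff.1 ht
      obtain rfl := List.forall₂_nil_right_iff.1 ht'
      simp only [List.map_cons, List.map_nil, List.flatten_cons, List.flatten_nil,
        List.append_nil] at hsort
      have hlen : l.length = k₁.inSorts.length + k₂.inSorts.length := by
        simpa using hsort.length_eq
      have hs₁ := List.forall₂_take_append l _ _ hsort
      have hs₂ := List.forall₂_drop_append l _ _ hsort
      have hl' := hl
      rw [← List.take_append_drop k₁.inSorts.length l, List.pairwise_append] at hl'
      have hb₁ : ∀ x ∈ l.take k₁.inSorts.length, lo ≤ x ∧ x < hi :=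
        fun x hx => hb x (List.mem_of_mem_take hx)
      have hb₂ : ∀ x ∈ l.drop k₁.inSorts.length, lo ≤ x ∧ x < hi :=
        fun x hx => hb x (List.mem_of_mem_drop hx)
      obtain ⟨mid, h₁, h₂, hm₁, hm₂⟩ := exists_separator hle hl'.2.2 hb₁ hb₂
      have htake : (l.drop k₁.inSorts.length).take k₂.inSorts.length =
          l.drop k₁.inSorts.length := List.take_of_length_le (by simp; omega)
      refine ⟨_, _, mid, rfl, ?_, ?_, h₁, h₂⟩
      · rw [← List.map_take]
        exact ih k₁ (by simp) hk₁ _ _ _ h₁ hl'.1 hm₁ hs₁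
      · rw [← List.map_drop, ← List.map_take, htake]
        exact ih k₂ (by simp) hk₂ _ _ _ h₂ hl'.2.1 hm₂ hs₂
    rcases hF _ hg with rfl | rfl | ⟨h0, -⟩
    · obtain ⟨x, y, mid, hxy, hx, hy, h₁, h₂⟩ := split rfl
      simp only [hxy]
      exact hx.add hy h₁ h₂
    · obtain ⟨x, y, mid, hxy, hx, hy, h₁, h₂⟩ := split rfl
      simp only [hxy]
      exact hx.mul hy h₁
    · simp [h0] at h1

theorem InOmega.exists_gt {e : ℕ → Fin 2} (he : InOmega e) (i N : ℕ) :
    ∃ j > N, e j = e i := by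
  obtain ⟨j, hj, hlt⟩ := (he i).exists_gt N
  exact ⟨j, hlt, hj⟩

/-- Applying the determinant to a binary matrix operation on two matrix terms of an `e`-sorted
sequence gives an element of its `FR` set. -/
theorem det_mem_FR {F : Set (HetOp (Fin 2) (MatU 𝔽 n))} (hdet : detOp 𝔽 n ∈ F)
    {g : HetOp (Fin 2) (MatU 𝔽 n)} (hg : g ∈ F) (hin : g.inSorts = [1, 1]) (hout : g.outSort = 1)
    {e : ℕ → Fin 2} (he : InOmega e) (he0 : e 0 = 0) {a : ℕ → MatU 𝔽 n}
    (ha : Sorted (matPhyla 𝔽 n) e a) {p q : ℕ} (hpq : p < q) (hp : e p = 1) (hq : e q = 1) :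
    (detOp 𝔽 n).fn [g.fn [a p, a q]] ∈ FR (matPhyla 𝔽 n) F e a := by
  obtain ⟨r, hr, hre⟩ := Filter.extraction_forall_of_frequently
    (P := fun k j => e j = e (k + 1) ∧ q < j) fun k => Filter.frequently_atTop.2 fun N => by
      obtain ⟨j, hj, hej⟩ := he.exists_gt (k + 1) (max N q)
      exact ⟨j, ((le_max_left _ _).trans_lt hj).le, hej, (le_max_right _ _).trans_lt hj⟩
  let φ : ℕ → List ℕ := fun k => Nat.casesOn k [p, q] fun k => [r k]
  let f : ℕ → HetOp (Fin 2) (MatU 𝔽 n) := fun k => Nat.casesOn k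
    ⟨([g].map HetOp.inSorts).flatten, (detOp 𝔽 n).outSort,
      fun xs => (detOp 𝔽 n).fn (applyChunks [g] xs)⟩
    fun k => ⟨[e (k + 1)], e (k + 1), fun xs => xs.headD (Sum.inl 0)⟩
  refine ⟨fun k => (f k).fn ((φ k).map a), ⟨φ, f, ?_, ?_, ?_, ?_, fun _ => rfl⟩, ?_, ?_⟩
  · rintro (_ | k)
    · refine OT.comp _ [g] hdet (fun h hh => ?_) ?_
      · rw [List.mem_singleton.1 hh]
        exact OT.base hg
      · simp [detOp, hout]
    · exact OT.id (e (k + 1)) _ rfl rfl fun x => rfl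
  · rintro (_ | k)
    · exact List.isChain_pair.2 hpq
    · exact List.isChain_singleton _
  · rintro (_ | j) (_ | k) hjk x hx y hy
    · omega
    · have := (hre k).2
      obtain rfl : y = r k := by simpa [φ] using hy
      have : x = p ∨ x = q := by simpa [φ] using hx
      omega
    · omega
    · have := hr (Nat.lt_of_succ_lt_succ hjk)
      obtain rfl : x = r j := by simpa [φ] using hx
      obtain rfl : y = r k := by simpa [φ] using hy
      exact this
  · rintro (_ | k)
    · have h₁ := ha p
      have h₂ := ha q
      rw [hp] at h₁
      rw [hq] at h₂
      simp [φ, f, hin, h₁, h₂]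
    · have := ha (r k)
      rw [(hre k).1] at this
      simpa [φ, f] using this
  · rintro (_ | k)
    · simp [f, φ, he0, matPhyla, detOp, applyChunks]
    · have := ha (r k)
      rw [(hre k).1] at this
      simpa [φ, f] using this
  · simp [f, φ, applyChunks, hin]

theorem not_isERamsey_of_matrixOpsAddMul [CharZero 𝔽] (hn : 0 < n)
    {F : Set (HetOp (Fin 2) (MatU 𝔽 n))} (hF : MatrixOpsAddMul F) (hadd : matAddOp 𝔽 n ∈ F)
    (hmul : matMulOp 𝔽 n ∈ F) (hdet : detOp 𝔽 n ∈ F) {e : ℕ → Fin 2} (he : InOmega e)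
    (he0 : e 0 = 0) (hnc : ∃ i j, e i ≠ e j) : ¬ IsERamsey (matPhyla 𝔽 n) F e := by
  intro hR
  obtain ⟨a, ⟨φ, f, hOT, hch, hlt, hsort, hfa⟩, ha, hX⟩ := hR (towerSeq 𝔽 n e)
    (towerSeq_sorted e) {x | ∃ T, SumLike T ∧ x = Sum.inl ((ofBits T : 𝔽) ^ n)} (by
      rintro _ ⟨T, -, rfl⟩
      simp [matPhyla, he0])
  obtain ⟨i, hi⟩ : ∃ i, e i = 1 := by
    obtain ⟨i, j, hij⟩ := hnc
    by_contra! h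
    have := h i
    have := h j
    omega
  obtain ⟨p, -, hp⟩ := he.exists_gt i 0
  obtain ⟨q, hpq, hq⟩ := he.exists_gt i p
  rw [hi] at hp hq
  have block : ∀ k, e k = 1 → ∀ lo hi, lo ≤ hi → (∀ x ∈ φ k, lo ≤ x ∧ x < hi) →
      IsBlockMat lo hi (a k) := by
    intro k hk lo hi hle hb
    have hak := ha k
    rw [hk, hfa k] at hak
    rw [hfa k]
    exact (hOT k).isBlockMat hF ((hOT k).outSort_eq_one hF (by simpa using hsort k) hak) _ _ _ hle
      (List.isChain_iff_pairwise.1 (hch k)) hb (hsort k)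
  have hbound : ∀ x ∈ φ p ++ φ q, 0 ≤ x ∧ x < (φ p ++ φ q).toFinset.sup (· + 1) := fun x hx =>
    ⟨x.zero_le, Nat.lt_of_succ_le
      (Finset.le_sup (f := (· + 1)) (List.mem_toFinset.2 hx))⟩
  obtain ⟨mid, h₁, h₂, hm₁, hm₂⟩ := exists_separator (Nat.zero_le _) (hlt p q hpq)
    (fun x hx => hbound x (List.mem_append_left _ hx))
    (fun x hx => hbound x (List.mem_append_right _ hx))
  obtain ⟨S, hS, haS⟩ := block p hp _ _ h₁ hm₁
  obtain ⟨T, hT, haT⟩ := block q hq _ _ h₂ hm₂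
  obtain ⟨-, hsum, hlike⟩ := hS.add hT h₁ h₂
  obtain ⟨R, -, hprod, hnlike⟩ := hS.mul hT h₁
  have hdetcast : ∀ k : ℕ, (k : Matrix (Fin n) (Fin n) 𝔽).det = (k : 𝔽) ^ n := fun k => by
    simp [← Matrix.diagonal_natCast']
  have memAdd := det_mem_FR hdet hadd rfl rfl he he0 ha hpq hp hq
  have memMul := det_mem_FR hdet hmul rfl rfl he he0 ha hpq hp hq
  have eqAdd : (detOp 𝔽 n).fn [(matAddOp 𝔽 n).fn [a p, a q]] =
      Sum.inl ((ofBits (S ∪ T) : 𝔽) ^ n) := by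
    rw [haS, haT]
    simp only [detOp, matAddOp, toMat, ← Nat.cast_add, hdetcast, hsum]
  have eqMul : (detOp 𝔽 n).fn [(matMulOp 𝔽 n).fn [a p, a q]] =
      Sum.inl ((ofBits R : 𝔽) ^ n) := by
    rw [haS, haT]
    simp only [detOp, matMulOp, toMat, ← Nat.cast_mul, hdetcast, hprod]
  rw [eqAdd] at memAdd
  rw [eqMul] at memMul
  rcases hX with hX | hX
  · obtain ⟨T', hT', heq⟩ := hX memMul
    have heq' : ofBits R ^ n = ofBits T' ^ n := by exact_mod_cast Sum.inl_injective heq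
    rw [ofBits_injective (Nat.pow_left_injective hn.ne' heq')] at hnlike
    exact hnlike hT'
  · exact (Set.eq_empty_iff_forall_notMem.1 hX _) ⟨memAdd, _, hlike, rfl⟩

theorem detOp_fn_mem_range (xs : List (MatU 𝔽 n)) : (detOp 𝔽 n).fn xs ∈ Set.range Sum.inl := by
  simp only [detOp]
  split <;> exact ⟨_, rfl⟩

theorem scalAddOp_fn_mem_range (xs : List (MatU 𝔽 n)) :
    (scalAddOp 𝔽 n).fn xs ∈ Set.range Sum.inl := by
  simp only [scalAddOp]
  split <;> exact ⟨_, rfl⟩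

theorem scalMulOp_fn_mem_range (xs : List (MatU 𝔽 n)) :
    (scalMulOp 𝔽 n).fn xs ∈ Set.range Sum.inl := by
  simp only [scalMulOp]
  split <;> exact ⟨_, rfl⟩

theorem matrixOpsAddMul_full : MatrixOpsAddMul
    {matAddOp 𝔽 n, matMulOp 𝔽 n, scalAddOp 𝔽 n, scalMulOp 𝔽 n, detOp 𝔽 n} := by
  rintro g (rfl | rfl | rfl | rfl | rfl)
  · exact Or.inl rfl
  · exact Or.inr (Or.inl rfl)
  · exact Or.inr (Or.inr ⟨rfl, scalAddOp_fn_mem_range⟩)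
  · exact Or.inr (Or.inr ⟨rfl, scalMulOp_fn_mem_range⟩)
  · exact Or.inr (Or.inr ⟨rfl, detOp_fn_mem_range⟩)

end Field

end HetRamsey

/-- for nonconstant `e ∈ Ω₀`, none of `(Mₙ(𝔽), 𝔽, +, ×, |·|)`,
`(Mₙ(𝔽), 𝔽, +, ×, +_𝔽, |·|)`, `(Mₙ(𝔽), 𝔽, +, ×, ×_𝔽, |·|)` and the full matrix
algebra is an `e`-Ramsey algebra. -/
theorem bothMatrixOps_det_reducts_not_eRamsey
    (𝔽 : Type) [Field 𝔽] [CharZero 𝔽] (n : ℕ) (hn : 0 < n)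
    (e : ℕ → Fin 2) (he : InOmega e) (he0 : e 0 = 0)
    (hnc : ∃ i j, e i ≠ e j) :
    ¬ IsERamsey (matPhyla 𝔽 n) {matAddOp 𝔽 n, matMulOp 𝔽 n, detOp 𝔽 n} e ∧
    ¬ IsERamsey (matPhyla 𝔽 n) {matAddOp 𝔽 n, matMulOp 𝔽 n, scalAddOp 𝔽 n, detOp 𝔽 n} e ∧
    ¬ IsERamsey (matPhyla 𝔽 n) {matAddOp 𝔽 n, matMulOp 𝔽 n, scalMulOp 𝔽 n, detOp 𝔽 n} e ∧
    ¬ IsERamsey (matPhyla 𝔽 n)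
        {matAddOp 𝔽 n, matMulOp 𝔽 n, scalAddOp 𝔽 n, scalMulOp 𝔽 n, detOp 𝔽 n} e := by
  refine ⟨?_, ?_, ?_, ?_⟩ <;>
  · refine not_isERamsey_of_matrixOpsAddMul hn (fun g hg => matrixOpsAddMul_full g ?_)
      (by simp) (by simp) (by simp) he he0 hnc
    simp only [Set.mem_insert_iff, Set.mem_singleton_iff] at hg ⊢
    tauto
end

section
/- Let 𝓐 = (A_0, A_1, 𝓕) be a two-phylum algebra with 𝓕 = 𝓖_0 ∪ 𝓖_1 ∪ {h}, where 𝓖_0 consists of operations on A_0 alone, 𝓖_1 consists of operations on A_1 alone, h : A_1 → A_0, 𝓖_0 and 𝓖_1 have the same signature, and h is a homomorphism from (A_1, 𝓖_1) into (A_0, 𝓖_0). Suppose β⃗ ∈ ^ω(im h), e⃗ ∈ Ω_0, and b⃗ is an e⃗-sorted sequence such that β⃗(i) = h(b⃗(i)) whenever e⃗(i) = 1 and b⃗(i) = β⃗(i) otherwise. Then: (i) for each N-ary orderly term f ∈ OT(𝓕) with codomain A_0 and all indices n_1 < ⋯ < n_N, there exists F' ∈ OT(𝓖_0) with f(b⃗(n_1),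 …, b⃗(n_N)) = F'(β⃗(n_1), …, β⃗(n_N)); and (ii) if u⃗ ≤_𝓕 b⃗ and u⃗ ∈ ^ωA_0, then u⃗ ≤_{𝓖_0} β⃗. -/
universe u v

open HetRamsey

namespace HetRamsey

variable {U : Type v}

/-- The map into the phylum `A 0` that applies `h` to elements of sort `1` and fixes the others. -/
def scalarize (h : HetOp (Fin 2) U) (ξ : Fin 2) (x : U) : U :=
  if ξ = 1 then h.fn [x] else x

/-- `f'` is an operation on `A 0` of the same arity as `f` which computes the scalarization of the
value of `f` from the scalarizations of its arguments; moreover `f` is well-sorted. -/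
structure IsScalarPart (A : Fin 2 → Set U) (h f f' : HetOp (Fin 2) U) : Prop where
  inSorts_eq : f'.inSorts = List.replicate f.inSorts.length 0
  outSort_eq : f'.outSort = 0
  wellSorted : WellSorted A f
  fn_eq : ∀ xs, List.Forall₂ (fun x ξ => x ∈ A ξ) xs f.inSorts →
    f'.fn (List.zipWith (scalarize h) f.inSorts xs) = scalarize h f.outSort (f.fn xs)

theorem zipWith_scalarize_replicate_zero (h : HetOp (Fin 2) U) (xs : List U) :
    List.zipWith (scalarize h) (List.replicate xs.length 0) xs = xs := by
  induction xs with
  | nil => rfl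
  | cons x xs ih => simp [List.replicate_succ, ih, scalarize]

theorem zipWith_scalarize_replicate_one (h : HetOp (Fin 2) U) (xs : List U) :
    List.zipWith (scalarize h) (List.replicate xs.length 1) xs = xs.map fun x => h.fn [x] := by
  induction xs with
  | nil => rfl
  | cons x xs ih => simp [List.replicate_succ, ih, scalarize]

theorem applyChunks_wellSorted {I : Type u} {A : I → Set U} {hs : List (HetOp I U)}
    (H : ∀ f ∈ hs, WellSorted A f) (xs : List U)
    (hxs : List.Forall₂ (fun x ξ => x ∈ A ξ) xs (hs.map HetOp.inSorts).flatten) :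
    List.Forall₂ (fun x ξ => x ∈ A ξ) (applyChunks hs xs) (hs.map HetOp.outSort) := by
  induction hs generalizing xs with
  | nil => exact .nil
  | cons f t ih =>
    rw [List.map_cons, List.flatten_cons] at hxs
    refine .cons (H f (by simp) _ ?_) (ih (fun g hg => H g (by simp [hg])) _ ?_)
    · simpa using List.forall₂_take f.inSorts.length hxs
    · simpa using List.forall₂_drop f.inSorts.length hxs

theorem applyChunks_zipWith_scalarize {A : Fin 2 → Set U} {h : HetOp (Fin 2) U}
    {hs hs' : List (HetOp (Fin 2) U)} (H : List.Forall₂ (IsScalarPart A h) hs hs') (xs : List U)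
    (hxs : List.Forall₂ (fun x ξ => x ∈ A ξ) xs (hs.map HetOp.inSorts).flatten) :
    applyChunks hs' (List.zipWith (scalarize h) (hs.map HetOp.inSorts).flatten xs) =
      List.zipWith (scalarize h) (hs.map HetOp.outSort) (applyChunks hs xs) := by
  induction H generalizing xs with
  | nil => rfl
  | @cons f f' t t' hf ht ih =>
    rw [List.map_cons, List.flatten_cons] at hxs
    have h1 := List.forall₂_take f.inSorts.length hxs
    have h2 := List.forall₂_drop f.inSorts.length hxs
    rw [List.take_left] at h1
    rw [List.drop_left] at h2
    simp only [applyChunks, List.map_cons, List.flatten_cons, List.zipWith_cons_cons,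
      hf.inSorts_eq, List.length_replicate, List.take_zipWith, List.drop_zipWith,
      List.take_left, List.drop_left, ih _ h2, hf.fn_eq _ h1]

theorem flatten_inSorts_of_isScalarPart {A : Fin 2 → Set U} {h : HetOp (Fin 2) U}
    {hs hs' : List (HetOp (Fin 2) U)} (H : List.Forall₂ (IsScalarPart A h) hs hs') :
    (hs'.map HetOp.inSorts).flatten =
      List.replicate (hs.map HetOp.inSorts).flatten.length 0 := by
  induction H with
  | nil => rfl
  | cons hf _ ih =>
    rw [List.map_cons, List.flatten_cons, ih, hf.inSorts_eq, List.map_cons, List.flatten_cons,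
      List.length_append, List.replicate_add]

theorem map_outSort_of_isScalarPart {A : Fin 2 → Set U} {h : HetOp (Fin 2) U}
    {hs hs' : List (HetOp (Fin 2) U)} (H : List.Forall₂ (IsScalarPart A h) hs hs') :
    hs'.map HetOp.outSort = List.replicate hs.length 0 := by
  induction H with
  | nil => rfl
  | cons hf _ ih => simp [ih, hf.outSort_eq, List.replicate_succ]

/-- Scalar parts are compatible with orderly composition. -/
theorem IsScalarPart.comp {A : Fin 2 → Set U} {h g g' : HetOp (Fin 2) U}
    {hs hs' : List (HetOp (Fin 2) U)} (hg : IsScalarPart A h g g')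
    (H : List.Forall₂ (IsScalarPart A h) hs hs') (hsort : hs.map HetOp.outSort = g.inSorts) :
    IsScalarPart A h
      ⟨(hs.map HetOp.inSorts).flatten, g.outSort, fun xs => g.fn (applyChunks hs xs)⟩
      ⟨(hs'.map HetOp.inSorts).flatten, g'.outSort, fun xs => g'.fn (applyChunks hs' xs)⟩ := by
  have hws : ∀ f ∈ hs, WellSorted A f := by
    clear hsort
    induction H with
    | nil => simp
    | cons hf _ ih => simpa using ⟨hf.wellSorted, ih⟩
  have key := applyChunks_wellSorted hws
  rw [hsort] at key
  refine ⟨flatten_inSorts_of_isScalarPart H, hg.outSort_eq, fun xs hxs => ?_, fun xs hxs => ?_⟩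
  · exact hg.wellSorted _ (key xs hxs)
  · simp only [applyChunks_zipWith_scalarize H xs hxs, hsort]
    exact hg.fn_eq _ (key xs hxs)

section TwoPhyla

variable {A : Fin 2 → Set U} {G0 G1 : Set (HetOp (Fin 2) U)} {h : HetOp (Fin 2) U}

/-- Every basic operation has a scalar part which is either a basic operation on `A 0` or the
identity of `A 0`. -/
theorem exists_isScalarPart_of_mem
    (hG0 : ∀ f ∈ G0, f.outSort = 0 ∧ (∀ ξ ∈ f.inSorts, ξ = 0) ∧ WellSorted A f)
    (hG1 : ∀ f ∈ G1, f.outSort = 1 ∧ (∀ ξ ∈ f.inSorts, ξ = 1) ∧ WellSorted A f)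
    (hin : h.inSorts = [1]) (hout : h.outSort = 0) (hws : WellSorted A h)
    {T : HetOp (Fin 2) U → HetOp (Fin 2) U} (hT : Set.MapsTo T G1 G0)
    (hTarity : ∀ F ∈ G1, (T F).inSorts.length = F.inSorts.length)
    (hhom : ∀ F ∈ G1, ∀ xs : List U,
        List.Forall₂ (fun x ξ => x ∈ A ξ) xs F.inSorts →
        h.fn [F.fn xs] = (T F).fn (xs.map fun x => h.fn [x]))
    {f : HetOp (Fin 2) U} (hf : f ∈ G0 ∪ G1 ∪ {h}) :
    ∃ f', IsScalarPart A h f f' ∧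
      (f' ∈ G0 ∨ f = h ∧ f'.inSorts = [0] ∧ ∀ x, f'.fn [x] = x) := by
  rcases hf with (hf | hf) | rfl
  · obtain ⟨ho, hi, hw⟩ := hG0 f hf
    have hr := List.eq_replicate_of_mem hi
    refine ⟨f, ⟨hr, ho, hw, fun xs hxs => ?_⟩, .inl hf⟩
    rw [hr, ← hxs.length_eq, zipWith_scalarize_replicate_zero]
    simp [scalarize, ho]
  · obtain ⟨ho, hi, hw⟩ := hG1 f hf
    obtain ⟨ho', hi', -⟩ := hG0 _ (hT hf)
    have hr := List.eq_replicate_of_mem hi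
    refine ⟨T f, ⟨hTarity f hf ▸ List.eq_replicate_of_mem hi', ho', hw, fun xs hxs => ?_⟩,
      .inl (hT hf)⟩
    rw [hr, ← hxs.length_eq, zipWith_scalarize_replicate_one, ← hhom f hf xs hxs]
    simp [scalarize, ho]
  · refine ⟨⟨[0], 0, fun l => l.headD (f.fn [])⟩, ⟨by simp [hin], rfl, hws, fun xs hxs => ?_⟩,
      .inr ⟨rfl, rfl, fun _ => rfl⟩⟩
    rw [hin] at hxs ⊢
    obtain ⟨x, _, -, hnil, rfl⟩ := List.forall₂_cons_right_iff.1 hxs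
    obtain rfl := List.forall₂_nil_right_iff.1 hnil
    simp [scalarize, hout]

/-- Every orderly term has a scalar part which is an orderly term over the operations on `A 0`. -/
theorem OT.exists_isScalarPart
    (hG0 : ∀ f ∈ G0, f.outSort = 0 ∧ (∀ ξ ∈ f.inSorts, ξ = 0) ∧ WellSorted A f)
    (hG1 : ∀ f ∈ G1, f.outSort = 1 ∧ (∀ ξ ∈ f.inSorts, ξ = 1) ∧ WellSorted A f)
    (hin : h.inSorts = [1]) (hout : h.outSort = 0) (hws : WellSorted A h)
    {T : HetOp (Fin 2) U → HetOp (Fin 2) U} (hT : Set.MapsTo T G1 G0)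
    (hTarity : ∀ F ∈ G1, (T F).inSorts.length = F.inSorts.length)
    (hhom : ∀ F ∈ G1, ∀ xs : List U,
        List.Forall₂ (fun x ξ => x ∈ A ξ) xs F.inSorts →
        h.fn [F.fn xs] = (T F).fn (xs.map fun x => h.fn [x]))
    {f : HetOp (Fin 2) U} (hf : OT (G0 ∪ G1 ∪ {h}) f) :
    ∃ f', OT G0 f' ∧ IsScalarPart A h f f' := by
  have base {g} := exists_isScalarPart_of_mem hG0 hG1 hin hout hws hT hTarity hhom (f := g)
  induction hf with
  | base hf =>
    obtain ⟨f', hp, hf' | ⟨-, hi, hx⟩⟩ := base hf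
    · exact ⟨f', .base hf', hp⟩
    · exact ⟨f', .id 0 f' hi hp.outSort_eq hx, hp⟩
  | id ξ c hi ho hx =>
    have key : ∀ xs, List.Forall₂ (fun x ξ => x ∈ A ξ) xs c.inSorts →
        ∃ x ∈ A ξ, xs = [x] := by
      intro xs hxs
      rw [hi] at hxs
      obtain ⟨x, _, hmem, hnil, rfl⟩ := List.forall₂_cons_right_iff.1 hxs
      obtain rfl := List.forall₂_nil_right_iff.1 hnil
      exact ⟨x, hmem, rfl⟩
    refine ⟨⟨[0], 0, c.fn⟩, .id 0 _ rfl rfl hx, by simp [hi], rfl, fun xs hxs => ?_,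
      fun xs hxs => ?_⟩
    · obtain ⟨x, hmem, rfl⟩ := key xs hxs
      rwa [hx, ho]
    · obtain ⟨x, -, rfl⟩ := key xs hxs
      simp [hi, ho, hx]
  | comp g hs hg _ hsort ih =>
    obtain ⟨hs', hOT, H⟩ : ∃ hs' : List (HetOp (Fin 2) U), (∀ f ∈ hs', OT G0 f) ∧
        List.Forall₂ (IsScalarPart A h) hs hs' := by
      clear hsort
      induction hs with
      | nil => exact ⟨[], by simp, .nil⟩
      | cons f t iht =>
        obtain ⟨f', hf', hp⟩ := ih f (by simp)
        obtain ⟨t', ht', H⟩ := iht (fun k hk => by simp_all) (fun k hk => ih k (by simp [hk]))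
        exact ⟨f' :: t', by simpa using ⟨hf', ht'⟩, .cons hp H⟩
    have hsort' : hs.map HetOp.outSort = g.inSorts := by
      rwa [← List.forall₂_eq_eq_eq, List.forall₂_map_left_iff]
    obtain ⟨g', hp, hg' | ⟨rfl, hi, hx⟩⟩ := base hg
    · refine ⟨_, .comp g' hs' hg' hOT ?_, hp.comp H hsort'⟩
      rw [← List.forall₂_map_left_iff (R := Eq), List.forall₂_eq_eq_eq,
        map_outSort_of_isScalarPart H, hp.inSorts_eq, ← hsort', List.length_map]
    · have hc := hp.comp H hsort'
      have hl : hs'.length = 1 := by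
        rw [← H.length_eq, ← List.length_map (f := HetOp.outSort), hsort', hin]; rfl
      obtain ⟨f', rfl⟩ := List.length_eq_one_iff.1 hl
      refine ⟨f', hOT f' (by simp), ?_⟩
      have hsorts := hc.inSorts_eq
      simp only [List.map_cons, List.map_nil, List.flatten_cons, List.flatten_nil,
        List.append_nil] at hsorts
      have ho : f'.outSort = 0 := by simpa [H.length_eq] using map_outSort_of_isScalarPart H
      refine ⟨hsorts, ho, hc.wellSorted, fun xs hxs => ?_⟩
      rw [← hc.fn_eq xs hxs]
      simp only [applyChunks, hx]
      rw [List.take_of_length_le]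
      simp [hsorts]

/-- Along a sequence `b` with scalarization `β`, scalarizing the arguments amounts to replacing `b`
by `β`. -/
theorem zipWith_scalarize_map (hdisj : Pairwise fun ξ η => Disjoint (A ξ) (A η))
    {β b : ℕ → U} {e : ℕ → Fin 2} (hb : Sorted A e b)
    (hbβ : ∀ i, (e i = 1 → β i = h.fn [b i]) ∧ (e i ≠ 1 → b i = β i))
    {ns : List ℕ} {sorts : List (Fin 2)} (hns : List.Forall₂ (fun i ξ => b i ∈ A ξ) ns sorts) :
    List.zipWith (scalarize h) sorts (ns.map b) = ns.map β := by
  induction hns with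
  | nil => rfl
  | @cons i ξ _ _ hi _ ih =>
    have hξ : e i = ξ := by
      by_contra hne
      exact Set.disjoint_left.1 (hdisj hne) (hb i) hi
    subst hξ
    rw [List.map_cons, List.zipWith_cons_cons, ih, List.map_cons, scalarize]
    split_ifs with h1
    · rw [(hbβ i).1 h1]
    · rw [(hbβ i).2 h1]

end TwoPhyla

end HetRamsey


/-- Lemma: let `(A 0, A 1, 𝓖₀ ∪ 𝓖₁ ∪ {h})` be a two-phylum
algebra where `𝓖₀` and `𝓖₁` have the same signature and `h` is a homomorphism
from `(A 1, 𝓖₁)` into `(A 0, 𝓖₀)`. Suppose `β⃗ ∈ ^ω(im h)`, `e ∈ Ω₀`, and `b⃗` is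
`e`-sorted with `β i = h (b i)` when `e i = 1` and `b i = β i` otherwise. Then
(i) every orderly term over `𝓕` with codomain `A 0` applied to terms of `b⃗`
equals some orderly term over `𝓖₀` applied to the corresponding terms of `β⃗`;
and (ii) every reduction `u⃗ ≤_𝓕 b⃗` with `u⃗ ∈ ^ω(A 0)` satisfies `u⃗ ≤_{𝓖₀} β⃗`. -/
theorem orderlyTerm_pushes_to_scalarPart_and_reduction_descends
    {U : Type v}
    (A : Fin 2 → Set U) (G0 G1 : Set (HetOp (Fin 2) U)) (hOp : HetOp (Fin 2) U)
    (hne : ∀ ξ, (A ξ).Nonempty)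
    (hdisj : Pairwise fun ξ η => Disjoint (A ξ) (A η))
    (hG0 : ∀ f ∈ G0, f.outSort = 0 ∧ (∀ ξ ∈ f.inSorts, ξ = 0) ∧ WellSorted A f)
    (hG1 : ∀ f ∈ G1, f.outSort = 1 ∧ (∀ ξ ∈ f.inSorts, ξ = 1) ∧ WellSorted A f)
    (hin : hOp.inSorts = [1]) (hout : hOp.outSort = 0) (hws : WellSorted A hOp)
    -- `𝓖₀` and `𝓖₁` have the same signature, via the arity-preserving bijection `T`
    (T : HetOp (Fin 2) U → HetOp (Fin 2) U)
    (hT : Set.BijOn T G1 G0)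
    (hTarity : ∀ F ∈ G1, (T F).inSorts.length = F.inSorts.length)
    -- `h` is a homomorphism from `(A 1, 𝓖₁)` into `(A 0, 𝓖₀)`
    (hhom : ∀ F ∈ G1, ∀ xs : List U,
        List.Forall₂ (fun x ξ => x ∈ A ξ) xs F.inSorts →
        hOp.fn [F.fn xs] = (T F).fn (xs.map fun x => hOp.fn [x]))
    -- `β⃗ ∈ ^ω(im h)`
    (β : ℕ → U) (hβ : ∀ i, β i ∈ (fun x => hOp.fn [x]) '' A 1)
    (e : ℕ → Fin 2) (he : InOmega e) (he0 : e 0 = 0)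
    (b : ℕ → U) (hb : Sorted A e b)
    (hbβ : ∀ i, (e i = 1 → β i = hOp.fn [b i]) ∧ (e i ≠ 1 → b i = β i)) :
    (∀ f : HetOp (Fin 2) U, OT (G0 ∪ G1 ∪ {hOp}) f → f.outSort = 0 →
      ∀ ns : List ℕ, ns.Chain' (· < ·) →
        List.Forall₂ (fun i ξ => b i ∈ A ξ) ns f.inSorts →
        ∃ F' : HetOp (Fin 2) U, OT G0 F' ∧ F'.inSorts.length = ns.length ∧
          f.fn (ns.map b) = F'.fn (ns.map β)) ∧
    (∀ u : ℕ → U, Reduction A (G0 ∪ G1 ∪ {hOp}) u b → (∀ i, u i ∈ A 0) →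
      Reduction A G0 u β) := by
  have key : ∀ f : HetOp (Fin 2) U, OT (G0 ∪ G1 ∪ {hOp}) f → ∃ F', OT G0 F' ∧
      F'.inSorts = List.replicate f.inSorts.length 0 ∧
      ∀ ns : List ℕ, List.Forall₂ (fun i ξ => b i ∈ A ξ) ns f.inSorts →
        f.fn (ns.map b) ∈ A f.outSort ∧
        (f.outSort = 0 → f.fn (ns.map b) = F'.fn (ns.map β)) := by
    intro f hf
    obtain ⟨F', hF', hp⟩ := hf.exists_isScalarPart hG0 hG1 hin hout hws hT.mapsTo hTarity hhom
    refine ⟨F', hF', hp.inSorts_eq, fun ns hns => ?_⟩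
    have hmem : List.Forall₂ (fun x ξ => x ∈ A ξ) (ns.map b) f.inSorts :=
      List.forall₂_map_left_iff.2 hns
    refine ⟨hp.wellSorted _ hmem, fun ho => ?_⟩
    rw [← zipWith_scalarize_map hdisj hb hbβ hns, hp.fn_eq _ hmem, ho]
    simp [scalarize]
  constructor
  · intro f hf ho ns _ hns
    obtain ⟨F', hF', hi, hval⟩ := key f hf
    exact ⟨F', hF', by rw [hi, List.length_replicate, hns.length_eq], (hval ns hns).2 ho⟩
  · rintro u ⟨φ, f, hf, hchain, hlt, hsorts, hu⟩ hu0
    choose F' hF' hi hval using fun j => key (f j) (hf j)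
    have hβ0 (i : ℕ) : β i ∈ A 0 := by
      obtain ⟨x, hx, hxi⟩ := hβ i
      rw [← hxi, ← hout]
      exact hws [x] (hin ▸ .cons hx .nil)
    refine ⟨φ, F', hF', hchain, hlt, fun j => ?_, fun j => ?_⟩
    · rw [hi, ← (hsorts j).length_eq, List.forall₂_iff_get]
      exact ⟨by simp, fun k _ _ => by simpa using hβ0 _⟩
    · obtain ⟨hm, hv⟩ := hval j (φ j) (hsorts j)
      rw [hu j]
      refine hv ?_
      by_contra hne
      exact Set.disjoint_left.1 (hdisj hne) hm (hu j ▸ hu0 j)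
end
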